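/- arXiv:1611.06261 — 2 statements merged into one kernel-verified Lean document; each statement's English description precedes it below -/
import Mathlib

section
/- Let (X, ℝ, α) be a nontrivial one-parameter C*-dynamical system such that X^α([0,∞)) is a maximal norm-closed subalgebra of X. Then there exists a norm-closed α-invariant α-simple two-sided ideal Y of X such that (i) Y^α((0,∞)) = X^α((0,∞)) and Y^α((−∞,0)) = X^α((−∞,0)) (spectral subspaces of the restricted system on Y), and (ii) Y + X^α([0,∞)) is norm-dense in X. -/
open MeasureTheory Set Filter Topology Pointwise

noncomputable section

namespace PeligradMax

variable {X : Type*} [NonUnitalNormedRing X] [StarRing X] [CStarRing X]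
  [NormedSpace ℂ X] [IsScalarTower ℂ X X] [SMulCommClass ℂ X X] [StarModule ℂ X]
  [CompleteSpace X] [PartialOrder X] [StarOrderedRing X]

/-- A one-parameter C*-dynamical system: a group of *-automorphisms of `X`
with norm-continuous orbit maps. -/
structure IsCStarDynSys (α : ℝ → X → X) : Prop where
  map_zero_time : ∀ x, α 0 x = x
  map_add_time : ∀ s t x, α (s + t) x = α s (α t x)
  map_add : ∀ t x y, α t (x + y) = α t x + α t y
  map_smulc : ∀ (t : ℝ) (c : ℂ) (x : X), α t (c • x) = c • α t x
  map_mul : ∀ t x y, α t (x * y) = α t x * α t y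
  map_star : ∀ t x, α t (star x) = star (α t x)
  continuous_orbit : ∀ x, Continuous fun t => α t x

/-- Closed linear span. -/
def ClosedSpan (S : Set X) : Set X := closure ((Submodule.span ℂ S : Submodule ℂ X) : Set X)

def MulSet2 (S T : Set X) : Set X := {z | ∃ s ∈ S, ∃ t ∈ T, z = s * t}

def MulSet3 (S T R : Set X) : Set X := {z | ∃ s ∈ S, ∃ t ∈ T, ∃ r ∈ R, z = s * t * r}

/-- Fourier transform of an integrable function. -/
def fourierT (f : ℝ → ℂ) (γ : ℝ) : ℂ := ∫ t : ℝ, f t * Complex.exp (-(Complex.I * γ * t))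

/-- `α_f(x) = ∫ f(t) α_t(x) dt`. -/
def smear (α : ℝ → X → X) (f : ℝ → ℂ) (x : X) : X := ∫ t : ℝ, f t • α t x

/-- Arveson spectrum of an element. -/
def elemSpec (α : ℝ → X → X) (x : X) : Set ℝ :=
  {γ | ∀ f : ℝ → ℂ, Integrable f → smear α f x = 0 → fourierT f γ = 0}

/-- Spectral subspace associated with a closed set `F ⊆ ℝ`. -/
def specC (α : ℝ → X → X) (F : Set ℝ) : Set X := {x | elemSpec α x ⊆ F}

/-- Spectral subspace of the subset `S` associated with an open set `U ⊆ ℝ`. -/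
def specO (α : ℝ → X → X) (S : Set X) (U : Set ℝ) : Set X :=
  ClosedSpan {y | ∃ x ∈ S, ∃ f : ℝ → ℂ, Integrable f ∧
    IsCompact (tsupport (fourierT f)) ∧ tsupport (fourierT f) ⊆ U ∧ y = smear α f x}

/-- The fixed point algebra `X^α`. -/
def fixedPts (α : ℝ → X → X) : Set X := {x | ∀ t, α t x = x}

/-- The Arveson spectrum of the action restricted to `S`. -/
def actSpec (α : ℝ → X → X) (S : Set X) : Set ℝ :=
  {γ : ℝ | ∀ ε > (0 : ℝ), S ∩ specC α (Icc (γ - ε) (γ + ε)) ≠ ({0} : Set X)}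

def Invariant (α : ℝ → X → X) (S : Set X) : Prop := ∀ t : ℝ, ∀ x ∈ S, α t x ∈ S

def IsSubalgebra (B : Set X) : Prop :=
  (0 : X) ∈ B ∧ (∀ x ∈ B, ∀ y ∈ B, x + y ∈ B) ∧
  (∀ c : ℂ, ∀ x ∈ B, c • x ∈ B) ∧ ∀ x ∈ B, ∀ y ∈ B, x * y ∈ B

def IsStarSubalgebra (B : Set X) : Prop := IsSubalgebra B ∧ ∀ x ∈ B, star x ∈ B

/-- `B` is a hereditary C*-subalgebra of the subset `S`. -/
def IsHereditaryIn (S B : Set X) : Prop :=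
  B ⊆ S ∧ IsClosed B ∧ IsStarSubalgebra B ∧
  ∀ x ∈ S, ∀ b ∈ B, 0 ≤ x → x ≤ b → x ∈ B

/-- `K` is a norm-closed two-sided ideal of the subset `S`. -/
def IsClosedTwoSidedIdealIn (S K : Set X) : Prop :=
  K ⊆ S ∧ IsClosed K ∧ (0 : X) ∈ K ∧ (∀ x ∈ K, ∀ y ∈ K, x + y ∈ K) ∧
  (∀ c : ℂ, ∀ x ∈ K, c • x ∈ K) ∧ ∀ s ∈ S, ∀ k ∈ K, s * k ∈ K ∧ k * s ∈ K

/-- `S` is `α`-simple: no nontrivial norm-closed `α`-invariant two-sided ideals. -/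
def AlphaSimple (α : ℝ → X → X) (S : Set X) : Prop :=
  ∀ K : Set X, IsClosedTwoSidedIdealIn S K → Invariant α K → K = ({0} : Set X) ∨ K = S

/-- The strong Arveson spectrum of the action restricted to `B`. -/
def strongSpec (α : ℝ → X → X) (B : Set X) : Set ℝ :=
  {γ : ℝ | ∀ ε > (0 : ℝ),
    ClosedSpan (MulSet3 (star '' (B ∩ specC α (Icc (γ - ε) (γ + ε)))) B
      (B ∩ specC α (Icc (γ - ε) (γ + ε)))) = B}

/-- The strong Connes spectrum of the action restricted to `S`. -/
def ConnesSpec (α : ℝ → X → X) (S : Set X) : Set ℝ :=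
  ⋂ B ∈ {B : Set X | IsHereditaryIn S B ∧ B ≠ ({0} : Set X) ∧ Invariant α B},
    strongSpec α B

def IsMaximalClosedSubalgebra (B : Set X) : Prop :=
  IsClosed B ∧ IsSubalgebra B ∧ B ≠ (univ : Set X) ∧
  ∀ W : Set X, IsClosed W → IsSubalgebra W → B ⊆ W → W = B ∨ W = univ

/-- The spectral Condition 4.3. -/
def Condition43 (α : ℝ → X → X) : Prop :=
  (∃ γ₀ : ℝ, 0 < γ₀ ∧ actSpec α (univ : Set X) = ({-γ₀, 0, γ₀} : Set ℝ) ∧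
    IsClosedTwoSidedIdealIn (fixedPts α)
      (ClosedSpan (MulSet2 (specC α ({γ₀} : Set ℝ)) (star '' specC α ({γ₀} : Set ℝ)))) ∧
    ∀ K : Set X,
      IsClosedTwoSidedIdealIn
        (ClosedSpan (MulSet2 (specC α ({γ₀} : Set ℝ)) (star '' specC α ({γ₀} : Set ℝ)))) K →
      K = ({0} : Set X) ∨
        K = ClosedSpan (MulSet2 (specC α ({γ₀} : Set ℝ)) (star '' specC α ({γ₀} : Set ℝ)))) ∨
  (∃ Y : Set X, IsClosedTwoSidedIdealIn (univ : Set X) Y ∧ Invariant α Y ∧ AlphaSimple α Y ∧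
    specO α Y (Ioi (0 : ℝ)) = specO α (univ : Set X) (Ioi (0 : ℝ)) ∧
    actSpec α Y = ConnesSpec α Y ∧
    closure (Y + specC α (Ici (0 : ℝ))) = (univ : Set X))

section Fourier

lemma fourierT_eq_fourier (f : ℝ → ℂ) (γ : ℝ) :
    fourierT f γ = FourierTransform.fourier f (γ / (2 * Real.pi)) := by
  rw [Real.fourier_real_eq_integral_exp_smul, fourierT]
  refine integral_congr_ae (Eventually.of_forall fun t => ?_)
  simp only [smul_eq_mul]
  rw [mul_comm]
  congr 2
  push_cast
  have : (Real.pi : ℂ) ≠ 0 := by exact_mod_cast Real.pi_ne_zero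
  field_simp

lemma fourier_eq_fourierT (f : ℝ → ℂ) (ξ : ℝ) :
    FourierTransform.fourier f ξ = fourierT f (2 * Real.pi * ξ) := by
  rw [fourierT_eq_fourier, mul_div_cancel_left₀]
  positivity

/-- Convolution of scalar functions on the line. -/
def conv (f g : ℝ → ℂ) : ℝ → ℂ := convolution f g (ContinuousLinearMap.mul ℂ ℂ) volume

lemma conv_apply (f g : ℝ → ℂ) (u : ℝ) : conv f g u = ∫ s, f s * g (u - s) := rfl

lemma integrable_conv {f g : ℝ → ℂ} (hf : Integrable f) (hg : Integrable g) :
    Integrable (conv f g) :=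
  hf.integrable_convolution _ hg

lemma fourierT_conv {f g : ℝ → ℂ} (hf : Integrable f) (hg : Integrable g) (γ : ℝ) :
    fourierT (conv f g) γ = fourierT f γ * fourierT g γ := by
  simp only [fourierT_eq_fourier, conv]
  exact Real.fourier_mul_convolution_eq hf hg _

lemma integrable_mul_exp {f : ℝ → ℂ} (hf : Integrable f) (γ : ℝ) :
    Integrable fun t : ℝ => f t * Complex.exp (-(Complex.I * γ * t)) := by
  refine hf.mul_bdd (c := 1) (by fun_prop) (Eventually.of_forall fun t => ?_)
  rw [Complex.norm_exp]
  simp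

lemma fourierT_sub {f g : ℝ → ℂ} (hf : Integrable f) (hg : Integrable g) (γ : ℝ) :
    fourierT (f - g) γ = fourierT f γ - fourierT g γ := by
  simp only [fourierT, Pi.sub_apply, sub_mul]
  exact integral_sub (integrable_mul_exp hf γ) (integrable_mul_exp hg γ)

lemma fourierT_modulate (f : ℝ → ℂ) (s γ : ℝ) :
    fourierT (fun t => Complex.exp (Complex.I * s * t) * f t) γ = fourierT f (γ - s) := by
  simp only [fourierT]
  refine integral_congr_ae (Eventually.of_forall fun t => ?_)
  simp only
  rw [mul_right_comm, mul_comm _ (f t), ← Complex.exp_add]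
  congr 2
  push_cast
  ring

lemma integrable_modulate {f : ℝ → ℂ} (hf : Integrable f) (s : ℝ) :
    Integrable fun t : ℝ => Complex.exp (Complex.I * s * t) * f t := by
  refine hf.bdd_mul (c := 1) (by fun_prop) (Eventually.of_forall fun t => ?_)
  rw [Complex.norm_exp]
  simp

lemma fourierT_conj (f : ℝ → ℂ) (γ : ℝ) :
    fourierT (fun t => star (f t)) γ = star (fourierT f (-γ)) := by
  simp only [fourierT, Complex.star_def]
  rw [← integral_conj]
  refine integral_congr_ae (Eventually.of_forall fun t => ?_)
  simp [← Complex.exp_conj]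

lemma fourierT_dilate (f : ℝ → ℂ) {ε : ℝ} (hε : 0 < ε) (γ : ℝ) :
    fourierT (fun t => ε * f (ε * t)) γ = fourierT f (γ / ε) := by
  have h := Measure.integral_comp_mul_left
    (fun t : ℝ => f t * Complex.exp (-(Complex.I * ((γ / ε : ℝ) : ℂ) * t))) ε
  have hε' : (ε : ℂ) ≠ 0 := by exact_mod_cast hε.ne'
  rw [abs_of_pos (inv_pos.2 hε), Complex.real_smul] at h
  rw [fourierT, fourierT, ← mul_right_inj' (inv_ne_zero hε'), ← Complex.ofReal_inv, ← h,
    ← integral_const_mul]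
  refine integral_congr_ae (Eventually.of_forall fun t => ?_)
  simp only
  push_cast
  rw [← mul_assoc, ← mul_assoc, inv_mul_cancel₀ hε', one_mul]
  congr 2
  field_simp

lemma integrable_dilate {f : ℝ → ℂ} (hf : Integrable f) {ε : ℝ} (hε : 0 < ε) :
    Integrable fun t : ℝ => (ε : ℂ) * f (ε * t) :=
  (hf.comp_mul_left' hε.ne').const_mul _

/-- Uniqueness for the Fourier transform of integrable functions. -/
lemma ae_eq_zero_of_fourierT_eq_zero {f : ℝ → ℂ} (hf : Integrable f)
    (h : ∀ γ, fourierT f γ = 0) : f =ᵐ[volume] 0 := by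
  refine ae_eq_zero_of_integral_contDiff_smul_eq_zero hf.locallyIntegrable fun g hg hgc => ?_
  have hG : ContDiff ℝ (⊤ : ℕ∞) (fun x => (g x : ℂ)) := Complex.ofRealCLM.contDiff.comp hg
  have hGc : HasCompactSupport (fun x => (g x : ℂ)) := hgc.comp_left Complex.ofReal_zero
  set G : SchwartzMap ℝ ℂ := hGc.toSchwartzMap hG
  have hGg : ∀ x, G x = g x := fun x => rfl
  set u : SchwartzMap ℝ ℂ := FourierTransformInv.fourierInv G
  have hu : FourierTransform.fourier u = G := FourierTransform.fourier_fourierInv_eq G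
  have hflip := VectorFourier.integral_fourierIntegral_smul_eq_flip (μ := volume) (ν := volume)
    (L := innerₗ ℝ) (e := Real.fourierChar) Real.continuous_fourierChar
    continuous_inner hf u.integrable
  rw [flip_innerₗ] at hflip
  have h1 : ∀ ξ, VectorFourier.fourierIntegral Real.fourierChar volume (innerₗ ℝ) f ξ = 0 :=
    fun ξ => (fourier_eq_fourierT f ξ).trans (h _)
  have h2 : ∀ ξ, VectorFourier.fourierIntegral Real.fourierChar volume (innerₗ ℝ) u ξ = g ξ := by
    intro ξ
    have := congrArg (fun v : SchwartzMap ℝ ℂ => v ξ) hu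
    rw [hGg] at this
    rw [← this, SchwartzMap.fourier_coe]
    rfl
  simp only [h1, h2, zero_smul, integral_zero] at hflip
  rw [hflip]
  refine integral_congr_ae (Eventually.of_forall fun t => ?_)
  simp [mul_comm]

/-- Schwartz functions whose Fourier transform is a plateau. -/
lemma exists_schwartz_plateau {r R : ℝ} (hr : 0 < r) (hrR : r < R) :
    ∃ φ : SchwartzMap ℝ ℂ, (∀ γ, |γ| ≤ r → fourierT φ γ = 1) ∧
      (∀ γ, R ≤ |γ| → fourierT φ γ = 0) ∧ φ 0 ≠ 0 := by
  have h2π : 0 < 2 * Real.pi := by positivity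
  let b : ContDiffBump (0 : ℝ) :=
    ⟨r / (2 * Real.pi), R / (2 * Real.pi), by positivity, by gcongr⟩
  have hG : ContDiff ℝ (⊤ : ℕ∞) (fun x => (b x : ℂ)) := Complex.ofRealCLM.contDiff.comp b.contDiff
  have hGc : HasCompactSupport (fun x => (b x : ℂ)) :=
    b.hasCompactSupport.comp_left Complex.ofReal_zero
  set G : SchwartzMap ℝ ℂ := hGc.toSchwartzMap hG
  have hGb : ∀ x, G x = b x := fun x => rfl
  have hF : ∀ γ, fourierT (FourierTransformInv.fourierInv G : SchwartzMap ℝ ℂ) γ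
      = b (γ / (2 * Real.pi)) := by
    intro γ
    rw [fourierT_eq_fourier, ← SchwartzMap.fourier_coe, FourierTransform.fourier_fourierInv_eq, hGb]
  refine ⟨FourierTransformInv.fourierInv G, fun γ hγ => ?_, fun γ hγ => ?_, ?_⟩
  · rw [hF, b.one_of_mem_closedBall, Complex.ofReal_one]
    rw [mem_closedBall_zero_iff, Real.norm_eq_abs, abs_div, abs_of_pos h2π]
    exact div_le_div_of_nonneg_right hγ h2π.le
  · rw [hF, b.zero_of_le_dist, Complex.ofReal_zero]
    rw [dist_zero_right, Real.norm_eq_abs, abs_div, abs_of_pos h2π]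
    exact div_le_div_of_nonneg_right hγ h2π.le
  · rw [SchwartzMap.fourierInv_coe, Real.fourierInv_eq']
    have : (∫ v : ℝ, (b v : ℂ)) = ((∫ v, b v : ℝ) : ℂ) := integral_ofReal
    simp [hGb, this, (b.integral_pos (μ := volume)).ne']

end Fourier

set_option linter.unusedSectionVars false

section IsoGroup

/-- The translation modulus of a scalar function in the `L¹` norm. -/
def transMod (h : ℝ → ℂ) (s : ℝ) : ℝ := ∫ t : ℝ, ‖h (t - s) - h t‖

lemma transMod_nonneg (h : ℝ → ℂ) (s : ℝ) : 0 ≤ transMod h s :=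
  integral_nonneg fun _ => norm_nonneg _

lemma transMod_le {h : ℝ → ℂ} (hh : Integrable h) (s : ℝ) :
    transMod h s ≤ 2 * ∫ t, ‖h t‖ := by
  have h1 : Integrable fun t => h (t - s) := hh.comp_sub_right s
  calc transMod h s ≤ ∫ t, (‖h (t - s)‖ + ‖h t‖) :=
        integral_mono (h1.sub hh).norm (h1.norm.add hh.norm) fun t => norm_sub_le _ _
    _ = 2 * ∫ t, ‖h t‖ := by
        rw [integral_add h1.norm hh.norm, integral_sub_right_eq_self (fun t => ‖h t‖) s]
        ring

lemma measurable_transMod {h : ℝ → ℂ} (hh : Continuous h) :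
    StronglyMeasurable (transMod h) := by
  have : Continuous fun p : ℝ × ℝ => ‖h (p.2 - p.1) - h p.2‖ := by fun_prop
  exact this.stronglyMeasurable.integral_prod_right

lemma transMod_dilate (h : ℝ → ℂ) {ε : ℝ} (hε : 0 < ε) (s : ℝ) :
    transMod (fun t => ε * h (ε * t)) s = transMod h (ε * s) := by
  have h1 := Measure.integral_comp_mul_left (fun t : ℝ => ‖h (t - ε * s) - h t‖) ε
  rw [abs_of_pos (inv_pos.2 hε), smul_eq_mul] at h1
  rw [transMod, transMod, ← mul_right_inj' (inv_ne_zero hε.ne'), ← h1, ← integral_const_mul]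
  refine integral_congr_ae (Eventually.of_forall fun t => ?_)
  simp only
  rw [← mul_sub, ← mul_sub, norm_mul, Complex.norm_real, Real.norm_eq_abs, abs_of_pos hε,
    inv_mul_cancel_left₀ hε.ne']

lemma tendsto_transMod (h : SchwartzMap ℝ ℂ) : Tendsto (transMod h) (𝓝 0) (𝓝 0) := by
  obtain ⟨C₀, hC₀⟩ := h.decay 0 0
  obtain ⟨C₂, hC₂⟩ := h.decay 2 0
  have hbd : ∀ u, ‖h u‖ * (1 + u ^ 2) ≤ C₀ + C₂ := fun u => by
    have h0 := hC₀.2 u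
    have h2 := hC₂.2 u
    simp only [pow_zero, one_mul, norm_iteratedFDeriv_zero, Real.norm_eq_abs, sq_abs] at h0 h2
    linarith
  have hint : Integrable fun t : ℝ => 4 * (C₀ + C₂) * (1 + t ^ 2)⁻¹ :=
    integrable_inv_one_add_sq.const_mul _
  have hlim : Tendsto (fun s => ∫ t : ℝ, ‖h (t - s) - h t‖) (𝓝 0) (𝓝 (∫ _ : ℝ, (0 : ℝ))) := by
    refine tendsto_integral_filter_of_dominated_convergence _
      (Eventually.of_forall fun s => ?_) ?_ hint (Eventually.of_forall fun t => ?_)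
    · exact (by fun_prop : Continuous fun t => ‖h (t - s) - h t‖).aestronglyMeasurable
    · filter_upwards [Metric.ball_mem_nhds (0 : ℝ) one_pos] with s hs
      refine Eventually.of_forall fun t => ?_
      rw [Metric.mem_ball, dist_zero_right, Real.norm_eq_abs, abs_lt] at hs
      rw [norm_norm, ← div_eq_mul_inv, le_div_iff₀ (by positivity)]
      have h1 := hbd (t - s)
      have h2 := hbd t
      have h3 : 1 + t ^ 2 ≤ 3 * (1 + (t - s) ^ 2) := by
        nlinarith [sq_nonneg (t - 2 * s), sq_nonneg (t - 3 / 2 * s), hs.1, hs.2]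
      have h4 : ‖h (t - s) - h t‖ ≤ ‖h (t - s)‖ + ‖h t‖ := norm_sub_le _ _
      have h5 := mul_le_mul_of_nonneg_right h4 (by positivity : 0 ≤ 1 + t ^ 2)
      have h6 := mul_le_mul_of_nonneg_left h3 (norm_nonneg (h (t - s)))
      linarith
    · have : Continuous fun s => ‖h (t - s) - h t‖ := by fun_prop
      simpa using this.tendsto 0
  rw [integral_zero] at hlim
  exact hlim

lemma tendsto_integral_transMod (h : SchwartzMap ℝ ℂ) {f : ℝ → ℂ} (hf : Integrable f) :
    Tendsto (fun ε => ∫ s, ‖f s‖ * transMod h (ε * s)) (𝓝 0) (𝓝 0) := by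
  have hlim : Tendsto (fun ε => ∫ s, ‖f s‖ * transMod h (ε * s)) (𝓝 0)
      (𝓝 (∫ _ : ℝ, (0 : ℝ))) := by
    refine tendsto_integral_filter_of_dominated_convergence
      (fun s => ‖f s‖ * (2 * ∫ t, ‖h t‖)) (Eventually.of_forall fun ε => ?_)
      (Eventually.of_forall fun ε => Eventually.of_forall fun s => ?_) (hf.norm.mul_const _)
      (Eventually.of_forall fun s => ?_)
    · exact hf.norm.aestronglyMeasurable.mul
        ((measurable_transMod h.continuous).comp_measurable
          (measurable_const_mul ε)).aestronglyMeasurable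
    · rw [norm_mul, norm_norm, Real.norm_eq_abs, abs_of_nonneg (transMod_nonneg _ _)]
      exact mul_le_mul_of_nonneg_left (transMod_le h.integrable _) (norm_nonneg _)
    · have h1 : Tendsto (fun ε : ℝ => ε * s) (𝓝 0) (𝓝 0) := by
        simpa using (continuous_mul_const s).tendsto (0 : ℝ)
      simpa using ((tendsto_transMod h).comp h1).const_mul ‖f s‖
  simpa using hlim

/-- A strongly continuous one-parameter group of contractions of the Banach space `X`. -/
structure IsIsoGroup (β : ℝ → X → X) : Prop where
  map_zero_time : ∀ x, β 0 x = x
  map_add_time : ∀ s t x, β (s + t) x = β s (β t x)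
  map_add : ∀ t x y, β t (x + y) = β t x + β t y
  map_smulc : ∀ (t : ℝ) (c : ℂ) (x : X), β t (c • x) = c • β t x
  norm_le : ∀ t x, ‖β t x‖ ≤ ‖x‖
  continuous_orbit : ∀ x, Continuous fun t => β t x

namespace IsIsoGroup

variable {β : ℝ → X → X}

/-- The operators of the group as continuous linear maps. -/
def toCLM (hβ : IsIsoGroup β) (t : ℝ) : X →L[ℂ] X :=
  LinearMap.mkContinuous ⟨⟨β t, hβ.map_add t⟩, hβ.map_smulc t⟩ 1 fun x => by
    simpa using hβ.norm_le t x

@[simp] lemma toCLM_apply (hβ : IsIsoGroup β) (t : ℝ) (x : X) : hβ.toCLM t x = β t x := rfl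

lemma integrable_smul (hβ : IsIsoGroup β) {f : ℝ → ℂ} (hf : Integrable f) (x : X) :
    Integrable fun t => f t • β t x := by
  refine (hf.norm.mul_const ‖x‖).mono'
    (hf.aestronglyMeasurable.smul (hβ.continuous_orbit x).aestronglyMeasurable)
    (Eventually.of_forall fun t => ?_)
  rw [norm_smul]
  exact mul_le_mul_of_nonneg_left (hβ.norm_le t x) (norm_nonneg _)

lemma norm_smear_le (hβ : IsIsoGroup β) {f : ℝ → ℂ} (hf : Integrable f) (x : X) :
    ‖smear β f x‖ ≤ (∫ t, ‖f t‖) * ‖x‖ := by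
  rw [← integral_mul_const]
  refine norm_integral_le_of_norm_le (hf.norm.mul_const _) (Eventually.of_forall fun t => ?_)
  rw [norm_smul]
  exact mul_le_mul_of_nonneg_left (hβ.norm_le t x) (norm_nonneg _)

/-- Smearing against an integrable function as a continuous linear map. -/
def smearCLM (hβ : IsIsoGroup β) {f : ℝ → ℂ} (hf : Integrable f) : X →L[ℂ] X :=
  LinearMap.mkContinuous
    ⟨⟨smear β f, fun x y => by
      simp only [smear, hβ.map_add, smul_add]
      exact integral_add (hβ.integrable_smul hf x) (hβ.integrable_smul hf y)⟩, fun c x => by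
      simp only [smear, hβ.map_smulc, smul_comm _ c, integral_smul, RingHom.id_apply]⟩
    (∫ t, ‖f t‖) (hβ.norm_smear_le hf)

@[simp] lemma smearCLM_apply (hβ : IsIsoGroup β) {f : ℝ → ℂ} (hf : Integrable f) (x : X) :
    hβ.smearCLM hf x = smear β f x := rfl

lemma smear_sub (hβ : IsIsoGroup β) {f g : ℝ → ℂ} (hf : Integrable f) (hg : Integrable g)
    (x : X) : smear β (f - g) x = smear β f x - smear β g x := by
  simp only [smear, Pi.sub_apply, sub_smul]
  exact integral_sub (hβ.integrable_smul hf x) (hβ.integrable_smul hg x)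

lemma smear_conv (hβ : IsIsoGroup β) {f g : ℝ → ℂ} (hf : Integrable f) (hg : Integrable g)
    (x : X) : smear β (conv f g) x = smear β f (smear β g x) := by
  have hprod : Integrable (fun p : ℝ × ℝ => f p.2 * g (p.1 - p.2)) :=
    hf.convolution_integrand (ContinuousLinearMap.mul ℂ ℂ) hg
  have hprod' : Integrable (Function.uncurry fun u s : ℝ => (f s * g (u - s)) • β u x)
      (volume.prod volume) := by
    refine (hprod.norm.mul_const ‖x‖).mono' (hprod.aestronglyMeasurable.smul
      ((hβ.continuous_orbit x).comp continuous_fst).aestronglyMeasurable)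
      (Eventually.of_forall fun p => ?_)
    simp only [Function.uncurry]
    rw [norm_smul]
    exact mul_le_mul_of_nonneg_left (hβ.norm_le _ x) (norm_nonneg _)
  have hR : smear β f (smear β g x) = ∫ s, ∫ u, (f s * g (u - s)) • β u x := by
    refine integral_congr_ae (Eventually.of_forall fun s => ?_)
    simp only
    rw [← hβ.toCLM_apply, smear,
      ← ContinuousLinearMap.integral_comp_comm _ (hβ.integrable_smul hg x), ← integral_smul,
      ← integral_sub_right_eq_self _ s]
    refine integral_congr_ae (Eventually.of_forall fun u => ?_)
    simp only [map_smul, toCLM_apply]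
    rw [← hβ.map_add_time, add_sub_cancel, smul_smul]
  rw [hR, ← integral_integral_swap hprod']
  refine integral_congr_ae (Eventually.of_forall fun u => ?_)
  simp only [conv_apply]
  rw [integral_smul_const]

lemma smear_eq_zero (_hβ : IsIsoGroup β) {f : ℝ → ℂ} (hf : Integrable f)
    (h : ∀ γ, fourierT f γ = 0) (x : X) : smear β f x = 0 := by
  refine integral_eq_zero_of_ae ?_
  filter_upwards [ae_eq_zero_of_fourierT_eq_zero hf h] with t ht
  simp [ht]

lemma smear_congr (hβ : IsIsoGroup β) {f g : ℝ → ℂ} (hf : Integrable f) (hg : Integrable g)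
    (h : ∀ γ, fourierT f γ = fourierT g γ) (x : X) : smear β f x = smear β g x := by
  rw [← sub_eq_zero, ← hβ.smear_sub hf hg]
  exact hβ.smear_eq_zero (hf.sub hg) (fun γ => by rw [fourierT_sub hf hg, h, sub_self]) x

lemma smear_comm (hβ : IsIsoGroup β) {f g : ℝ → ℂ} (hf : Integrable f) (hg : Integrable g)
    (x : X) : smear β f (smear β g x) = smear β g (smear β f x) := by
  rw [← hβ.smear_conv hf hg, ← hβ.smear_conv hg hf]
  exact hβ.smear_congr (integrable_conv hf hg) (integrable_conv hg hf)
    (fun γ => by rw [fourierT_conv hf hg, fourierT_conv hg hf, mul_comm]) x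

/-- A vector annihilated by all modulations of a Schwartz function not vanishing at the origin
is zero. -/
lemma eq_zero_of_smear_modulate (hβ : IsIsoGroup β) {φ : SchwartzMap ℝ ℂ} (hφ : φ 0 ≠ 0) {y : X}
    (h : ∀ s : ℝ, smear β (fun t => Complex.exp (Complex.I * s * t) * φ t) y = 0) : y = 0 := by
  have hc : Continuous fun t => φ t • β t y := φ.continuous.smul (hβ.continuous_orbit y)
  have hF : FourierTransform.fourier (fun t => φ t • β t y) = 0 := by
    funext ξ
    rw [Real.fourier_real_eq_integral_exp_smul, Pi.zero_apply, ← h (-(2 * Real.pi * ξ))]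
    refine integral_congr_ae (Eventually.of_forall fun t => ?_)
    simp only
    rw [smul_smul]
    congr 3
    push_cast
    ring
  have hinv := hc.fourierInv_fourier_eq (hβ.integrable_smul φ.integrable y)
    (by rw [hF]; exact integrable_zero _ _ _)
  have h0 := congrFun hinv 0
  rw [hF, Real.fourierInv_eq'] at h0
  have h1 : φ 0 • y = 0 := by simpa [hβ.map_zero_time, eq_comm] using h0
  exact (smul_eq_zero.1 h1).resolve_left hφ

lemma norm_sub_le_transMod (hβ : IsIsoGroup β) {h : ℝ → ℂ} (hh : Integrable h) {y : X}
    (hy : smear β h y = y) (s : ℝ) : ‖β s y - y‖ ≤ transMod h s * ‖y‖ := by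
  have h1 : Integrable fun t => h (t - s) := hh.comp_sub_right s
  have h2 : β s y = smear β (fun t => h (t - s)) y := by
    conv_lhs => rw [← hy]
    rw [← hβ.toCLM_apply, smear,
      ← ContinuousLinearMap.integral_comp_comm _ (hβ.integrable_smul hh y),
      ← integral_sub_right_eq_self _ s]
    refine integral_congr_ae (Eventually.of_forall fun u => ?_)
    simp only [map_smul, toCLM_apply]
    rw [← hβ.map_add_time, add_sub_cancel]
  calc ‖β s y - y‖ = ‖smear β ((fun t => h (t - s)) - h) y‖ := by
        rw [hβ.smear_sub h1 hh, ← h2, hy]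
    _ ≤ _ := hβ.norm_smear_le (h1.sub hh) y

/-- Multiplying the group by a character. -/
lemma twist (hβ : IsIsoGroup β) (γ : ℝ) :
    IsIsoGroup fun t x => Complex.exp (Complex.I * γ * t) • β t x where
  map_zero_time x := by simp [hβ.map_zero_time]
  map_add_time s t x := by
    rw [hβ.map_smulc, smul_smul, ← Complex.exp_add, hβ.map_add_time]
    congr 2
    push_cast
    ring
  map_add t x y := by rw [hβ.map_add, smul_add]
  map_smulc t c x := by rw [hβ.map_smulc, smul_comm]
  norm_le t x := by
    rw [norm_smul, Complex.norm_exp]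
    simpa using hβ.norm_le t x
  continuous_orbit x := by
    have := hβ.continuous_orbit x
    fun_prop

lemma smear_twist (f : ℝ → ℂ) (γ : ℝ) (x : X) :
    smear (fun t x => Complex.exp (Complex.I * γ * t) • β t x)
      (fun t => Complex.exp (Complex.I * ((-γ : ℝ) : ℂ) * t) * f t) x = smear β f x := by
  refine integral_congr_ae (Eventually.of_forall fun t => ?_)
  simp only
  rw [smul_smul, mul_right_comm, ← Complex.exp_add]
  simp

lemma exists_radius_zero (hβ : IsIsoGroup β) {f : ℝ → ℂ} (hf : Integrable f) {x : X}
    (hfx : smear β f x = 0) (h0 : fourierT f 0 ≠ 0) :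
    ∃ ε > 0, ∀ g : ℝ → ℂ, Integrable g → (∀ γ, ε ≤ |γ| → fourierT g γ = 0) →
      smear β g x = 0 := by
  obtain ⟨h, h1, -, -⟩ := exists_schwartz_plateau one_pos one_lt_two
  have hev := (tendsto_integral_transMod h hf).eventually (gt_mem_nhds (norm_pos_iff.2 h0))
  obtain ⟨ε, hεlt, hε⟩ :=
    ((hev.filter_mono nhdsWithin_le_nhds).and (self_mem_nhdsWithin (s := Ioi (0 : ℝ)))).exists
  refine ⟨ε, hε, fun g hg hsupp => ?_⟩
  have hε : 0 < ε := hε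
  set y := smear β g x with hy
  have hhε := integrable_dilate h.integrable hε
  have hyy : smear β (fun t => ε * h (ε * t)) y = y := by
    rw [hy, ← hβ.smear_conv hhε hg]
    refine hβ.smear_congr (integrable_conv hhε hg) hg (fun γ => ?_) x
    rw [fourierT_conv hhε hg, fourierT_dilate _ hε]
    rcases le_total ε |γ| with hγ | hγ
    · rw [hsupp γ hγ, mul_zero]
    · rw [h1, one_mul]
      rw [abs_div, abs_of_pos hε]
      exact (div_le_one hε).2 hγ
  have hfy : smear β f y = 0 := by
    rw [hy, hβ.smear_comm hf hg, hfx, ← hβ.smearCLM_apply hg, map_zero]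
  by_contra hne
  have hint : Integrable fun s => ‖f s‖ * transMod h (ε * s) := by
    refine (hf.norm.mul_const (2 * ∫ t, ‖h t‖)).mono' (hf.norm.aestronglyMeasurable.mul
        ((measurable_transMod h.continuous).comp_measurable
          (measurable_const_mul ε)).aestronglyMeasurable) (Eventually.of_forall fun s => ?_)
    rw [norm_mul, norm_norm, Real.norm_eq_abs, abs_of_nonneg (transMod_nonneg _ _)]
    exact mul_le_mul_of_nonneg_left (transMod_le h.integrable _) (norm_nonneg _)
  have hkey : ‖fourierT f 0 • y‖ ≤ (∫ s, ‖f s‖ * transMod h (ε * s)) * ‖y‖ := by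
    have e : fourierT f 0 • y = -∫ s, f s • (β s y - y) := by
      simp only [smul_sub]
      rw [integral_sub (hβ.integrable_smul hf y) (hf.smul_const y), integral_smul_const]
      change _ = -(smear β f y - _)
      rw [hfy, zero_sub, neg_neg]
      simp [fourierT]
    rw [e, norm_neg, ← integral_mul_const]
    refine norm_integral_le_of_norm_le (hint.mul_const _) (Eventually.of_forall fun s => ?_)
    rw [norm_smul, mul_assoc]
    refine mul_le_mul_of_nonneg_left ?_ (norm_nonneg _)
    rw [← transMod_dilate _ hε]
    exact hβ.norm_sub_le_transMod hhε hyy s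
  rw [norm_smul] at hkey
  exact absurd (le_of_mul_le_mul_right hkey (norm_pos_iff.2 hne)) (not_le.2 hεlt)

/-- A local form of Wiener's theorem: off the Arveson spectrum, smearing vanishes locally. -/
lemma exists_radius (hβ : IsIsoGroup β) {x : X} {γ₀ : ℝ} (hγ₀ : γ₀ ∉ elemSpec β x) :
    ∃ ε > 0, ∀ g : ℝ → ℂ, Integrable g → (∀ γ ∉ Metric.ball γ₀ ε, fourierT g γ = 0) →
      smear β g x = 0 := by
  simp only [elemSpec, mem_ofPred_eq, not_forall] at hγ₀
  obtain ⟨f, hf, hfx, hf0⟩ := hγ₀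
  obtain ⟨ε, hε, h⟩ := (hβ.twist γ₀).exists_radius_zero (integrable_modulate hf (-γ₀))
    ((smear_twist f γ₀ x).trans hfx) (by rw [fourierT_modulate]; simpa using hf0)
  refine ⟨ε, hε, fun g hg hsupp => ?_⟩
  rw [← smear_twist g γ₀ x]
  refine h _ (integrable_modulate hg (-γ₀)) fun γ hγ => ?_
  rw [fourierT_modulate]
  refine hsupp _ ?_
  rw [Metric.mem_ball, Real.dist_eq, not_lt]
  rwa [show γ - -γ₀ - γ₀ = γ by ring]

/-- Smearing against a function whose Fourier transform lives on a compact set disjoint from the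
Arveson spectrum gives zero. -/
lemma smear_eq_zero_of_disjoint (hβ : IsIsoGroup β) {x : X} {K : Set ℝ} (hK : IsCompact K)
    (hKx : Disjoint K (elemSpec β x)) {g : ℝ → ℂ} (hg : Integrable g)
    (hsupp : ∀ γ ∉ K, fourierT g γ = 0) : smear β g x = 0 := by
  choose! ε hε hloc using fun γ (hγ : γ ∈ K) => hβ.exists_radius (hKx.notMem_of_mem_left hγ)
  obtain ⟨δ, hδ, hcov⟩ := lebesgue_number_lemma_of_metric hK
    (c := fun γ : K => Metric.ball (γ : ℝ) (ε γ)) (fun _ => Metric.isOpen_ball)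
    fun γ hγ => mem_iUnion.2 ⟨⟨γ, hγ⟩, Metric.mem_ball_self (hε γ hγ)⟩
  obtain ⟨φ, -, hφ, hφ0⟩ :=
    exists_schwartz_plateau (r := δ / 4) (R := δ / 2) (by positivity) (by linarith)
  refine hβ.eq_zero_of_smear_modulate hφ0 fun s => ?_
  have hφs := integrable_modulate φ.integrable s
  rw [← hβ.smear_conv hφs hg]
  have hFT : ∀ γ, fourierT (conv (fun t => Complex.exp (Complex.I * s * t) * φ t) g) γ
      = fourierT φ (γ - s) * fourierT g γ := fun γ => by
    rw [fourierT_conv hφs hg, fourierT_modulate]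
  by_cases hs : ∃ γ ∈ K, |γ - s| < δ / 2
  · obtain ⟨γ, hγK, hγs⟩ := hs
    obtain ⟨i, hi⟩ := hcov γ hγK
    refine hloc i i.2 _ (integrable_conv hφs hg) fun γ' hγ' => ?_
    rw [hFT]
    rcases le_or_gt (δ / 2) |γ' - s| with h | h
    · rw [hφ _ h, zero_mul]
    · refine absurd (hi ?_) hγ'
      rw [Metric.mem_ball, Real.dist_eq]
      calc |γ' - γ| ≤ |γ' - s| + |s - γ| := abs_sub_le _ _ _
        _ < δ := by rw [abs_sub_comm s γ]; linarith
  · push Not at hs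
    refine hβ.smear_eq_zero (integrable_conv hφs hg) (fun γ => ?_) x
    rw [hFT]
    by_cases hγ : γ ∈ K
    · rw [hφ _ (hs γ hγ), zero_mul]
    · rw [hsupp γ hγ, mul_zero]

/-- A vector with Arveson spectrum in `{0}` is fixed by the group. -/
lemma fixed_of_elemSpec_subset (hβ : IsIsoGroup β) {x : X} (hx : elemSpec β x ⊆ {0}) (s : ℝ) :
    β s x = x := by
  obtain ⟨h, h1, -, -⟩ := exists_schwartz_plateau one_pos one_lt_two
  obtain ⟨φ, -, hφ, hφ0⟩ := exists_schwartz_plateau one_pos one_lt_two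
  have hfix : ∀ ε > 0, smear β (fun t => ε * h (ε * t)) x = x := by
    intro ε hε
    have hhε := integrable_dilate h.integrable hε
    refine (sub_eq_zero.1 <| hβ.eq_zero_of_smear_modulate hφ0 fun s => ?_).symm
    have hφs := integrable_modulate φ.integrable s
    have hcv := integrable_conv hφs hhε
    rw [← hβ.smearCLM_apply hφs, map_sub, smearCLM_apply, smearCLM_apply,
      ← hβ.smear_conv hφs hhε, ← hβ.smear_sub hφs hcv]
    refine hβ.smear_eq_zero_of_disjoint (K := Metric.closedBall s 2 \ Metric.ball 0 ε)
      ((isCompact_closedBall s 2).diff Metric.isOpen_ball) ?_ (hφs.sub hcv) fun γ hγ => ?_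
    · refine Disjoint.mono_right hx (disjoint_singleton_right.2 fun h => h.2 ?_)
      exact Metric.mem_ball_self hε
    · rw [fourierT_sub hφs hcv, fourierT_conv hφs hhε, fourierT_modulate, fourierT_dilate _ hε]
      by_cases hγ2 : |γ - s| ≤ 2
      · rw [h1, mul_one, sub_self]
        have : |γ| < ε := by
          by_contra hlt
          exact hγ ⟨by simpa [Real.dist_eq] using hγ2, by simpa using hlt⟩
        rw [abs_div, abs_of_pos hε]
        exact (div_le_one hε).2 this.le
      · rw [hφ _ (not_le.1 hγ2).le, zero_mul, sub_self]
  have hlim : Tendsto (fun ε : ℝ => transMod h (ε * s) * ‖x‖) (𝓝[>] 0) (𝓝 0) := by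
    have h1 : Tendsto (fun ε : ℝ => ε * s) (𝓝[>] 0) (𝓝 0) := by
      simpa using ((continuous_mul_const s).tendsto (0 : ℝ)).mono_left nhdsWithin_le_nhds
    simpa using ((tendsto_transMod h).comp h1).mul_const ‖x‖
  have hle : ‖β s x - x‖ ≤ 0 := by
    refine ge_of_tendsto hlim ?_
    filter_upwards [self_mem_nhdsWithin] with ε hε
    rw [← transMod_dilate _ hε]
    exact hβ.norm_sub_le_transMod (integrable_dilate h.integrable hε) (hfix ε hε) s
  exact sub_eq_zero.1 (norm_le_zero_iff.1 hle)

lemma smear_mem (hβ : IsIsoGroup β) {J : Submodule ℂ X} (hJ : IsClosed (J : Set X))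
    (hinv : Invariant β (J : Set X)) {f : ℝ → ℂ} (hf : Integrable f) {x : X} (hx : x ∈ J) :
    smear β f x ∈ J := by
  have : IsClosed (J : Set X) := hJ
  rw [← Submodule.Quotient.mk_eq_zero, ← Submodule.mkQ_apply, ← Submodule.mkQL_apply, smear,
    ← ContinuousLinearMap.integral_comp_comm _ (hβ.integrable_smul hf x)]
  refine integral_eq_zero_of_ae (Eventually.of_forall fun t => ?_)
  simp only [Submodule.mkQL_apply, Submodule.mkQ_apply, Pi.zero_apply]
  exact (Submodule.Quotient.mk_eq_zero _).2 (J.smul_mem _ (hinv t x hx))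

end IsIsoGroup

end IsoGroup

section CStarDynSys

/-- Functions whose Fourier transform vanishes off a compact subset of `U`. -/
def FourierSupp (f : ℝ → ℂ) (U : Set ℝ) : Prop :=
  Integrable f ∧ ∃ K, IsCompact K ∧ K ⊆ U ∧ ∀ γ ∉ K, fourierT f γ = 0

lemma fourierSupp_of_tsupport {f : ℝ → ℂ} {U : Set ℝ} (hf : Integrable f)
    (hc : IsCompact (tsupport (fourierT f))) (hU : tsupport (fourierT f) ⊆ U) :
    FourierSupp f U :=
  ⟨hf, _, hc, hU, fun _ => image_eq_zero_of_notMem_tsupport⟩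

lemma integrable_star {f : ℝ → ℂ} (hf : Integrable f) : Integrable fun t => star (f t) :=
  Complex.conjLIE.integrable_comp_iff.2 hf

lemma FourierSupp.conj {f : ℝ → ℂ} {U : Set ℝ} (hf : FourierSupp f U) :
    FourierSupp (fun t => star (f t)) (-U) := by
  obtain ⟨hf, K, hK, hKU, hs⟩ := hf
  refine ⟨(integrable_star hf), -K, hK.neg, neg_subset_neg.2 hKU, fun γ hγ => ?_⟩
  rw [fourierT_conj, hs _ (by simpa using hγ), star_zero]

variable {α : ℝ → X → X}

namespace IsCStarDynSys

lemma isIsoGroup (hα : IsCStarDynSys α) : IsIsoGroup α where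
  map_zero_time := hα.map_zero_time
  map_add_time := hα.map_add_time
  map_add := hα.map_add
  map_smulc := hα.map_smulc
  norm_le t x := by
    let _ : NonUnitalCStarAlgebra X := { }
    have h0 : α t 0 = 0 := by simpa using hα.map_smulc t 0 0
    let φ : X →⋆ₙₐ[ℂ] X :=
      { toFun := α t
        map_smul' := hα.map_smulc t
        map_zero' := h0
        map_add' := hα.map_add t
        map_mul' := hα.map_mul t
        map_star' := hα.map_star t }
    exact NonUnitalStarAlgHom.norm_apply_le φ x
  continuous_orbit := hα.continuous_orbit

lemma smear_star (hα : IsCStarDynSys α) {f : ℝ → ℂ} (hf : Integrable f) (x : X) :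
    smear α (fun t => star (f t)) (star x) = star (smear α f x) := by
  have h := ContinuousLinearMap.integral_comp_commSL (σ := starRingEnd ℂ)
    (fun r x => by simp) (starL ℂ (A := X)).toContinuousLinearMap
    (hα.isIsoGroup.integrable_smul hf x)
  rw [smear, smear]
  refine Eq.trans (integral_congr_ae (Eventually.of_forall fun t => ?_)) h
  simp [hα.map_star]

lemma neg_mem_elemSpec_star (hα : IsCStarDynSys α) {x : X} {γ : ℝ} (h : γ ∈ elemSpec α x) :
    -γ ∈ elemSpec α (star x) := by
  intro f hf hfx
  have h1 := hα.smear_star hf (star x)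
  rw [hfx, star_zero, star_star] at h1
  have h2 := h _ (integrable_star hf) h1
  rw [fourierT_conj] at h2
  exact star_eq_zero.1 h2

end IsCStarDynSys

/-- A norm-closed `α`-invariant self-adjoint two-sided ideal of `X`. -/
structure IsStarIdeal (α : ℝ → X → X) (J : Submodule ℂ X) : Prop where
  isClosed : IsClosed (J : Set X)
  invariant : Invariant α (J : Set X)
  star_mem : ∀ x ∈ J, star x ∈ J
  mul_mem_left : ∀ x, ∀ y ∈ J, x * y ∈ J

namespace IsStarIdeal

lemma mul_mem_right {J : Submodule ℂ X} (hJ : IsStarIdeal α J) (x : X) {y : X} (hy : y ∈ J) :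
    y * x ∈ J := by
  simpa using hJ.star_mem _ (hJ.mul_mem_left (star x) _ (hJ.star_mem _ hy))

lemma isClosedTwoSidedIdealIn {J : Submodule ℂ X} (hJ : IsStarIdeal α J) :
    IsClosedTwoSidedIdealIn (univ : Set X) (J : Set X) :=
  ⟨subset_univ _, hJ.isClosed, J.zero_mem, fun _ hx _ hy => J.add_mem hx hy,
    fun c _ hx => J.smul_mem c hx, fun s _ _ hk => ⟨hJ.mul_mem_left s _ hk, hJ.mul_mem_right s hk⟩⟩

lemma sInf {S : Set (Submodule ℂ X)} (hS : ∀ J ∈ S, IsStarIdeal α J) :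
    IsStarIdeal α (sInf S) where
  isClosed := by
    rw [Submodule.coe_sInf]
    exact isClosed_biInter fun J hJ => (hS J hJ).isClosed
  invariant t x hx := by
    simp only [SetLike.mem_coe, Submodule.mem_sInf] at hx ⊢
    exact fun J hJ => (hS J hJ).invariant t x (hx J hJ)
  star_mem x hx := by
    simp only [Submodule.mem_sInf] at hx ⊢
    exact fun J hJ => (hS J hJ).star_mem x (hx J hJ)
  mul_mem_left x y hy := by
    simp only [Submodule.mem_sInf] at hy ⊢
    exact fun J hJ => (hS J hJ).mul_mem_left x y (hy J hJ)

/-- The largest self-adjoint two-sided ideal of `X` inside an ideal `K` of an ideal `Y`. -/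
def core {S K : Set X} (hK : IsClosedTwoSidedIdealIn S K) : Submodule ℂ X where
  carrier := {z | ∀ w, (w = z ∨ w = star z) →
    w ∈ K ∧ (∀ x, x * w ∈ K) ∧ (∀ x, w * x ∈ K) ∧ ∀ x x', x * w * x' ∈ K}
  zero_mem' := by
    rintro w (rfl | rfl) <;> simp [hK.2.2.1]
  add_mem' {a b} ha hb := by
    have hadd := hK.2.2.2.1
    rintro w (rfl | rfl)
    · obtain ⟨a1, a2, a3, a4⟩ := ha a (Or.inl rfl)
      obtain ⟨b1, b2, b3, b4⟩ := hb b (Or.inl rfl)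
      simp only [mul_add, add_mul]
      exact ⟨hadd _ a1 _ b1, fun x => hadd _ (a2 x) _ (b2 x), fun x => hadd _ (a3 x) _ (b3 x),
        fun x x' => hadd _ (a4 x x') _ (b4 x x')⟩
    · obtain ⟨a1, a2, a3, a4⟩ := ha _ (Or.inr rfl)
      obtain ⟨b1, b2, b3, b4⟩ := hb _ (Or.inr rfl)
      simp only [star_add, mul_add, add_mul]
      exact ⟨hadd _ a1 _ b1, fun x => hadd _ (a2 x) _ (b2 x), fun x => hadd _ (a3 x) _ (b3 x),
        fun x x' => hadd _ (a4 x x') _ (b4 x x')⟩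
  smul_mem' c a ha := by
    have hsm := hK.2.2.2.2.1
    rintro w (rfl | rfl)
    · obtain ⟨a1, a2, a3, a4⟩ := ha a (Or.inl rfl)
      simp only [mul_smul_comm, smul_mul_assoc]
      exact ⟨hsm c _ a1, fun x => hsm c _ (a2 x), fun x => hsm c _ (a3 x),
        fun x x' => hsm c _ (a4 x x')⟩
    · obtain ⟨a1, a2, a3, a4⟩ := ha _ (Or.inr rfl)
      simp only [star_smul, mul_smul_comm, smul_mul_assoc]
      exact ⟨hsm _ _ a1, fun x => hsm _ _ (a2 x), fun x => hsm _ _ (a3 x),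
        fun x x' => hsm _ _ (a4 x x')⟩

lemma mem_core {S K : Set X} (hK : IsClosedTwoSidedIdealIn S K) {z : X} :
    z ∈ core hK ↔ ∀ w, (w = z ∨ w = star z) →
      w ∈ K ∧ (∀ x, x * w ∈ K) ∧ (∀ x, w * x ∈ K) ∧ ∀ x x', x * w * x' ∈ K := Iff.rfl

lemma core_subset {S K : Set X} (hK : IsClosedTwoSidedIdealIn S K) :
    (core hK : Set X) ⊆ K := fun z hz => (hz z (Or.inl rfl)).1

lemma isStarIdeal_core (hα : IsCStarDynSys α) {S K : Set X} (hK : IsClosedTwoSidedIdealIn S K)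
    (hinv : Invariant α K) : IsStarIdeal α (core hK) where
  isClosed := by
    have hcl := hK.2.1
    have : (core hK : Set X) = ⋂ w ∈ ({id, star} : Set (X → X)),
        ({z | w z ∈ K} ∩ ((⋂ x, {z | x * w z ∈ K}) ∩ ((⋂ x, {z | w z * x ∈ K}) ∩
          ⋂ x, ⋂ x', {z | x * w z * x' ∈ K}))) := by
      ext z
      simp [mem_core]
    rw [this]
    refine isClosed_biInter fun w hw => ?_
    have hwc : Continuous w := by
      rcases hw with rfl | rfl
      · exact continuous_id
      · exact continuous_star
    refine (hcl.preimage hwc).inter (IsClosed.inter ?_ (IsClosed.inter ?_ ?_))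
    · exact isClosed_iInter fun x => hcl.preimage (f := fun z => x * w z) (by fun_prop)
    · exact isClosed_iInter fun x => hcl.preimage (f := fun z => w z * x) (by fun_prop)
    · exact isClosed_iInter fun x => isClosed_iInter fun x' =>
        hcl.preimage (f := fun z => x * w z * x') (by fun_prop)
  invariant t z hz := by
    have hback : ∀ x, α t (α (-t) x) = x := fun x => by
      rw [← hα.map_add_time, add_neg_cancel, hα.map_zero_time]
    have key : ∀ w, (w ∈ K ∧ (∀ x, x * w ∈ K) ∧ (∀ x, w * x ∈ K) ∧ ∀ x x', x * w * x' ∈ K) →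
        (α t w ∈ K ∧ (∀ x, x * α t w ∈ K) ∧ (∀ x, α t w * x ∈ K) ∧
          ∀ x x', x * α t w * x' ∈ K) := by
      rintro w ⟨h1, h2, h3, h4⟩
      refine ⟨hinv t _ h1, fun x => ?_, fun x => ?_, fun x x' => ?_⟩
      · rw [← hback x, ← hα.map_mul]
        exact hinv t _ (h2 _)
      · rw [← hback x, ← hα.map_mul]
        exact hinv t _ (h3 _)
      · rw [← hback x, ← hback x', ← hα.map_mul, ← hα.map_mul]
        exact hinv t _ (h4 _ _)
    rintro w (rfl | rfl)
    · exact key z (hz z (Or.inl rfl))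
    · rw [← hα.map_star]
      exact key _ (hz _ (Or.inr rfl))
  star_mem z hz := by
    rintro w (rfl | rfl)
    · exact hz _ (Or.inr rfl)
    · rw [star_star]
      exact hz z (Or.inl rfl)
  mul_mem_left y z hz := by
    obtain ⟨-, a2, -, a4⟩ := hz z (Or.inl rfl)
    obtain ⟨-, -, b3, b4⟩ := hz _ (Or.inr rfl)
    rintro w (rfl | rfl)
    · refine ⟨a2 y, fun x => ?_, fun x => a4 y x, fun x x' => ?_⟩
      · rw [← mul_assoc]
        exact a2 _
      · rw [← mul_assoc]
        exact a4 _ _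
    · rw [star_mul]
      refine ⟨b3 _, fun x => ?_, fun x => ?_, fun x x' => ?_⟩
      · rw [← mul_assoc]
        exact b4 _ _
      · rw [mul_assoc]
        exact b3 _
      · rw [← mul_assoc, mul_assoc _ (star y)]
        exact b4 _ _

/-- If the core vanishes, so does the ideal. -/
lemma eq_zero_of_core_eq_bot {J : Submodule ℂ X} (hJ : IsStarIdeal α J) {K : Set X}
    (hK : IsClosedTwoSidedIdealIn (J : Set X) K) (h : core hK = ⊥) {k : X} (hk : k ∈ K) :
    k = 0 := by
  have hkJ : k ∈ J := hK.1 hk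
  have hskJ : star k ∈ J := hJ.star_mem _ hkJ
  have hl : ∀ s ∈ J, ∀ k ∈ K, s * k ∈ K := fun s hs k hk => (hK.2.2.2.2.2 s hs k hk).1
  have hr : ∀ s ∈ J, ∀ k ∈ K, k * s ∈ K := fun s hs k hk => (hK.2.2.2.2.2 s hs k hk).2
  have hmid : ∀ a ∈ J, ∀ b ∈ J, a * k * (star k * b) ∈ K := fun a ha b hb =>
    hr _ (hJ.mul_mem_left _ _ hb) _ (hl _ ha _ hk)
  have hmem : star k * k * (star k * k) ∈ core hK := by
    have hsa : star (star k * k * (star k * k)) = star k * k * (star k * k) := by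
      simp [star_mul]
    rintro w hw
    obtain rfl : w = star k * k * (star k * k) := by simpa only [hsa, or_self] using hw
    refine ⟨hmid _ hskJ _ hkJ, fun x => ?_, fun x => ?_, fun x x' => ?_⟩
    · rw [← mul_assoc, ← mul_assoc x]
      exact hmid _ (hJ.mul_mem_left _ _ hskJ) _ hkJ
    · rw [mul_assoc, mul_assoc (star k) k x]
      exact hmid _ hskJ _ (hJ.mul_mem_right _ hkJ)
    · rw [← mul_assoc x, ← mul_assoc x, mul_assoc _ _ x', mul_assoc (star k) k x']
      exact hmid _ (hJ.mul_mem_left _ _ hskJ) _ (hJ.mul_mem_right _ hkJ)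
  rw [h, Submodule.mem_bot] at hmem
  have h1 : star (star k * k) * (star k * k) = 0 := by simpa [star_mul] using hmem
  exact CStarRing.star_mul_self_eq_zero_iff k |>.1
    (CStarRing.star_mul_self_eq_zero_iff (star k * k) |>.1 h1)

/-- The two-sided annihilator of a self-adjoint ideal. -/
def annihilator (J : Submodule ℂ X) : Submodule ℂ X where
  carrier := {x | ∀ j ∈ J, j * x = 0 ∧ x * j = 0}
  zero_mem' := fun j _ => by simp
  add_mem' {a b} ha hb := fun j hj => by
    simp [mul_add, add_mul, (ha j hj).1, (ha j hj).2, (hb j hj).1, (hb j hj).2]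
  smul_mem' c a ha := fun j hj => by
    simp [mul_smul_comm, smul_mul_assoc, (ha j hj).1, (ha j hj).2]

lemma mem_annihilator {J : Submodule ℂ X} {x : X} :
    x ∈ annihilator J ↔ ∀ j ∈ J, j * x = 0 ∧ x * j = 0 := Iff.rfl

lemma isStarIdeal_annihilator (hα : IsCStarDynSys α) {J : Submodule ℂ X}
    (hJ : IsStarIdeal α J) : IsStarIdeal α (annihilator J) where
  isClosed := by
    have : (annihilator J : Set X) = ⋂ j ∈ J, ({x | j * x = 0} ∩ {x | x * j = 0}) := by
      ext x
      simp [mem_annihilator]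
    rw [this]
    exact isClosed_biInter fun j _ => (isClosed_eq (by fun_prop) continuous_const).inter
      (isClosed_eq (by fun_prop) continuous_const)
  invariant t x hx j hj := by
    have hback : α t (α (-t) j) = j := by
      rw [← hα.map_add_time, add_neg_cancel, hα.map_zero_time]
    have h0 : α t 0 = 0 := by simpa using hα.map_smulc t 0 0
    obtain ⟨h1, h2⟩ := hx _ (hJ.invariant (-t) j hj)
    rw [← hback, ← hα.map_mul, ← hα.map_mul, h1, h2]
    exact ⟨h0, h0⟩
  star_mem x hx j hj := by
    obtain ⟨h1, h2⟩ := hx _ (hJ.star_mem j hj)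
    exact ⟨star_injective (by simpa using h2), star_injective (by simpa using h1)⟩
  mul_mem_left x y hy j hj := by
    rw [← mul_assoc, mul_assoc x, (hy j hj).2, mul_zero]
    exact ⟨(hy _ (hJ.mul_mem_right x hj)).1, rfl⟩

end IsStarIdeal

namespace IsCStarDynSys

lemma smear_eq_zero_of_mem_specC (hα : IsCStarDynSys α) {f : ℝ → ℂ}
    (hf : FourierSupp f (Iio 0)) {x : X} (hx : x ∈ specC α (Ici (0 : ℝ))) :
    smear α f x = 0 := by
  obtain ⟨hf, K, hK, hKU, hs⟩ := hf
  refine hα.isIsoGroup.smear_eq_zero_of_disjoint hK ?_ hf hs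
  exact (Iio_disjoint_Ici le_rfl).mono hKU hx

lemma fixed_of_mem_specC (hα : IsCStarDynSys α) {x : X} (hx : x ∈ specC α (Ici (0 : ℝ)))
    (hx' : star x ∈ specC α (Ici (0 : ℝ))) (t : ℝ) : α t x = x := by
  refine hα.isIsoGroup.fixed_of_elemSpec_subset (fun γ hγ => ?_) t
  exact le_antisymm (neg_nonneg.1 (hx' (hα.neg_mem_elemSpec_star hγ))) (hx hγ)

lemma mul_smear_eq_zero (hα : IsCStarDynSys α) {J : Submodule ℂ X} (hJ : IsStarIdeal α J)
    (hJA : (J : Set X) ⊆ specC α (Ici (0 : ℝ))) {f : ℝ → ℂ} {U : Set ℝ} (hf : FourierSupp f U)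
    (hU : (0 : ℝ) ∉ U) {j : X} (hj : j ∈ J) (x : X) : j * smear α f x = 0 := by
  obtain ⟨hf, K, -, hKU, hs⟩ := hf
  have hfix : ∀ y ∈ J, ∀ t, α t y = y := fun y hy t =>
    hα.fixed_of_mem_specC (hJA hy) (hJA (hJ.star_mem y hy)) t
  have h0 : ∫ t, f t = 0 := by simpa [fourierT] using hs 0 fun h => hU (hKU h)
  rw [smear, ← ContinuousLinearMap.mul_apply' ℂ X,
    ← ContinuousLinearMap.integral_comp_comm _ (hα.isIsoGroup.integrable_smul hf x)]
  have : ∀ t, ContinuousLinearMap.mul ℂ X j (f t • α t x) = f t • (j * x) := fun t => by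
    rw [map_smul, ContinuousLinearMap.mul_apply']
    conv_lhs => rw [← hfix j hj t]
    rw [← hα.map_mul, hfix _ (hJ.mul_mem_right x hj)]
  simp only [this]
  rw [integral_smul_const, h0, zero_smul]

lemma smear_mem_annihilator (hα : IsCStarDynSys α) {J : Submodule ℂ X} (hJ : IsStarIdeal α J)
    (hJA : (J : Set X) ⊆ specC α (Ici (0 : ℝ))) {f : ℝ → ℂ} {U : Set ℝ} (hf : FourierSupp f U)
    (hU : (0 : ℝ) ∉ U) (x : X) : smear α f x ∈ IsStarIdeal.annihilator J := by
  intro j hj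
  refine ⟨hα.mul_smear_eq_zero hJ hJA hf hU hj x, star_injective ?_⟩
  rw [star_mul, ← hα.smear_star hf.1, star_zero]
  exact hα.mul_smear_eq_zero hJ hJA hf.conj (by simpa using hU) (hJ.star_mem j hj) _

/-- An ideal containing the negative spectral subspace is not contained in `X^α([0,∞))`. -/
lemma not_subset_of_smear_mem (hα : IsCStarDynSys α)
    (hA : specC α (Ici (0 : ℝ)) ≠ (univ : Set X)) {J : Set X}
    (hJ : ∀ f, FourierSupp f (Iio 0) → ∀ x, smear α f x ∈ J) :
    ¬ J ⊆ specC α (Ici (0 : ℝ)) := by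
  intro hJA
  refine hA (eq_univ_of_forall fun x γ hγ => ?_)
  by_contra hneg
  have hγ0 : γ < 0 := not_le.1 hneg
  obtain ⟨φ, hφ1, hφ2, -⟩ := exists_schwartz_plateau (r := -γ / 4) (R := -γ / 2)
    (by linarith) (by linarith)
  set f : ℝ → ℂ := fun t => Complex.exp (Complex.I * γ * t) * φ t
  have hfi : Integrable f := integrable_modulate φ.integrable γ
  have hf : FourierSupp f (Iio 0) := by
    refine ⟨hfi, Metric.closedBall γ (-γ / 2), isCompact_closedBall _ _, fun γ' hγ' => ?_,
      fun γ' hγ' => ?_⟩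
    · rw [Metric.mem_closedBall, Real.dist_eq] at hγ'
      have := le_abs_self (γ' - γ)
      rw [mem_Iio]
      linarith
    · rw [Metric.mem_closedBall, Real.dist_eq, not_le] at hγ'
      rw [fourierT_modulate, hφ2 _ hγ'.le]
  have h0 := hα.smear_eq_zero_of_mem_specC hf (hJA (hJ f hf x))
  rw [← hα.isIsoGroup.smear_conv hfi hfi] at h0
  have h1 := hγ _ (integrable_conv hfi hfi) h0
  rw [fourierT_conv hfi hfi, fourierT_modulate, sub_self,
    hφ1 0 (by rw [abs_zero]; linarith)] at h1
  simp at h1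

lemma closure_add_eq_univ (hmax : IsMaximalClosedSubalgebra (specC α (Ici (0 : ℝ))))
    {J : Submodule ℂ X} (hJ : IsStarIdeal α J) (hJA : ¬ (J : Set X) ⊆ specC α (Ici (0 : ℝ))) :
    closure ((J : Set X) + specC α (Ici (0 : ℝ))) = univ := by
  obtain ⟨-, ⟨hzero, hadd, hsmul, hmul⟩, -, hmax⟩ := hmax
  have hJsub : (J : Set X) ⊆ (J : Set X) + specC α (Ici (0 : ℝ)) :=
    fun j hj => ⟨j, hj, 0, hzero, add_zero j⟩
  have hAsub : specC α (Ici (0 : ℝ)) ⊆ (J : Set X) + specC α (Ici (0 : ℝ)) :=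
    fun a ha => ⟨0, J.zero_mem, a, ha, zero_add a⟩
  refine (hmax _ isClosed_closure ⟨?_, ?_, ?_, ?_⟩ (hAsub.trans subset_closure)).resolve_left
    fun h => hJA ((hJsub.trans subset_closure).trans h.subset)
  · exact subset_closure (hAsub hzero)
  · refine fun x hx y hy => map_mem_closure₂ continuous_add hx hy ?_
    rintro _ ⟨j, hj, a, ha, rfl⟩ _ ⟨j', hj', a', ha', rfl⟩
    exact ⟨j + j', J.add_mem hj hj', a + a', hadd a ha a' ha', add_add_add_comm _ _ _ _⟩
  · refine fun c x hx => map_mem_closure (continuous_const_smul c) hx ?_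
    rintro _ ⟨j, hj, a, ha, rfl⟩
    exact ⟨c • j, J.smul_mem c hj, c • a, hsmul c a ha, (smul_add c j a).symm⟩
  · refine fun x hx y hy => map_mem_closure₂ continuous_mul hx hy ?_
    rintro _ ⟨j, hj, a, ha, rfl⟩ _ ⟨j', hj', a', ha', rfl⟩
    refine ⟨j * (j' + a') + a * j', J.add_mem (hJ.mul_mem_right _ hj) (hJ.mul_mem_left _ _ hj'),
      a * a', hmul a ha a' ha', ?_⟩
    simp only [add_mul, mul_add]
    abel

lemma smear_mem_closure_of_neg (hα : IsCStarDynSys α)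
    (hmax : IsMaximalClosedSubalgebra (specC α (Ici (0 : ℝ))))
    {J : Submodule ℂ X} (hJ : IsStarIdeal α J) (hJA : ¬ (J : Set X) ⊆ specC α (Ici (0 : ℝ)))
    {f : ℝ → ℂ} (hf : FourierSupp f (Iio 0)) (x : X) :
    smear α f x ∈ closure (smear α f '' (J : Set X)) := by
  have hx : x ∈ closure ((J : Set X) + specC α (Ici (0 : ℝ))) := by
    rw [closure_add_eq_univ hmax hJ hJA]
    trivial
  refine map_mem_closure (hα.isIsoGroup.smearCLM hf.1).continuous hx ?_
  rintro _ ⟨j, hj, a, ha, rfl⟩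
  refine ⟨j, hj, ?_⟩
  have hadd := _root_.map_add (hα.isIsoGroup.smearCLM hf.1) j a
  simp only [IsIsoGroup.smearCLM_apply, hα.smear_eq_zero_of_mem_specC hf ha, add_zero] at hadd
  exact hadd.symm

lemma smear_mem_closure_of_pos (hα : IsCStarDynSys α)
    (hmax : IsMaximalClosedSubalgebra (specC α (Ici (0 : ℝ))))
    {J : Submodule ℂ X} (hJ : IsStarIdeal α J) (hJA : ¬ (J : Set X) ⊆ specC α (Ici (0 : ℝ)))
    {f : ℝ → ℂ} (hf : FourierSupp f (Ioi 0)) (x : X) :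
    smear α f x ∈ closure (smear α f '' (J : Set X)) := by
  have hf' := hf.conj
  rw [neg_Ioi, neg_zero] at hf'
  have h := hα.smear_mem_closure_of_neg hmax hJ hJA hf' (star x)
  rw [hα.smear_star hf.1] at h
  rw [← star_star (smear α f x)]
  refine map_mem_closure continuous_star h ?_
  rintro _ ⟨j, hj, rfl⟩
  refine ⟨star j, hJ.star_mem j hj, star_injective ?_⟩
  rw [← hα.smear_star hf.1, star_star, star_star]

lemma specO_eq_of_smear_mem_closure (J : Set X) {U : Set ℝ}
    (h : ∀ f, FourierSupp f U → ∀ x, smear α f x ∈ closure (smear α f '' J)) :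
    specO α J U = specO α (univ : Set X) U := by
  refine Subset.antisymm (closure_mono (Submodule.span_mono ?_)) ?_
  · rintro _ ⟨x, -, f, hf⟩
    exact ⟨x, trivial, f, hf⟩
  · refine closure_minimal ?_ isClosed_closure
    rw [specO, ClosedSpan, ← Submodule.topologicalClosure_coe, SetLike.coe_subset_coe,
      Submodule.span_le, Submodule.topologicalClosure_coe]
    rintro _ ⟨x, -, f, hf, hc, hU, rfl⟩
    refine closure_mono ?_ (h f (fourierSupp_of_tsupport hf hc hU) x)
    rintro _ ⟨y, hy, rfl⟩
    exact Submodule.subset_span ⟨y, hy, f, hf, hc, hU, rfl⟩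

end IsCStarDynSys

end CStarDynSys

/-- **Lemma 4.10.** If `X^α([0,∞))` is a maximal norm-closed subalgebra of a nontrivial
one-parameter C*-dynamical system, then there is a norm-closed `α`-invariant `α`-simple
two-sided ideal `Y` of `X` with `Y^α((0,∞)) = X^α((0,∞))`, `Y^α((−∞,0)) = X^α((−∞,0))`,
and `Y + X^α([0,∞))` norm-dense in `X`. -/
theorem exists_simple_ideal_of_maximal (α : ℝ → X → X) (hα : IsCStarDynSys α)
    (hnontrivial : actSpec α (univ : Set X) ≠ ({0} : Set ℝ))
    (hmax : IsMaximalClosedSubalgebra (specC α (Ici (0 : ℝ)))) :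
    ∃ Y : Set X, IsClosedTwoSidedIdealIn (univ : Set X) Y ∧ Invariant α Y ∧
      AlphaSimple α Y ∧
      specO α Y (Ioi (0 : ℝ)) = specO α (univ : Set X) (Ioi (0 : ℝ)) ∧
      specO α Y (Iio (0 : ℝ)) = specO α (univ : Set X) (Iio (0 : ℝ)) ∧
      closure (Y + specC α (Ici (0 : ℝ))) = (univ : Set X) := by
  have hA := hmax.2.2.1
  set 𝒥 : Set (Submodule ℂ X) :=
    {J | IsStarIdeal α J ∧ ¬ (J : Set X) ⊆ specC α (Ici (0 : ℝ))}
  have hY : IsStarIdeal α (sInf 𝒥) := IsStarIdeal.sInf fun J hJ => hJ.1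
  have hle : ∀ J, IsStarIdeal α J → ¬ (J : Set X) ⊆ specC α (Ici (0 : ℝ)) → sInf 𝒥 ≤ J :=
    fun J h1 h2 => sInf_le ⟨h1, h2⟩
  have hYA : ¬ ((sInf 𝒥 : Submodule ℂ X) : Set X) ⊆ specC α (Ici (0 : ℝ)) := by
    refine hα.not_subset_of_smear_mem hA fun f hf x => Submodule.mem_sInf.2 fun J hJ => ?_
    refine closure_minimal ?_ hJ.1.isClosed (hα.smear_mem_closure_of_neg hmax hJ.1 hJ.2 hf x)
    rintro _ ⟨j, hj, rfl⟩
    exact hα.isIsoGroup.smear_mem hJ.1.isClosed hJ.1.invariant hf.1 hj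
  refine ⟨_, hY.isClosedTwoSidedIdealIn, hY.invariant, fun K hK hKinv => ?_,
    IsCStarDynSys.specO_eq_of_smear_mem_closure _ fun f hf x =>
      hα.smear_mem_closure_of_pos hmax hY hYA hf x,
    IsCStarDynSys.specO_eq_of_smear_mem_closure _ fun f hf x =>
      hα.smear_mem_closure_of_neg hmax hY hYA hf x,
    IsCStarDynSys.closure_add_eq_univ hmax hY hYA⟩
  have hC := IsStarIdeal.isStarIdeal_core hα hK hKinv
  have hCK := IsStarIdeal.core_subset hK
  by_cases hCA : (IsStarIdeal.core hK : Set X) ⊆ specC α (Ici (0 : ℝ))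
  · left
    have hann : sInf 𝒥 ≤ IsStarIdeal.annihilator (IsStarIdeal.core hK) :=
      hle _ (IsStarIdeal.isStarIdeal_annihilator hα hC) <|
        hα.not_subset_of_smear_mem hA fun f hf x =>
          hα.smear_mem_annihilator hC hCA hf (by simp) x
    have hbot : IsStarIdeal.core hK = ⊥ := by
      refine (Submodule.eq_bot_iff _).2 fun k hk => ?_
      have := (hann (hK.1 (hCK hk)) _ (hC.star_mem k hk)).1
      exact (CStarRing.star_mul_self_eq_zero_iff k).1 this
    refine Subset.antisymm (fun k hk => hY.eq_zero_of_core_eq_bot hK hbot hk) ?_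
    exact singleton_subset_iff.2 hK.2.2.1
  · exact Or.inr (Subset.antisymm hK.1 (Subset.trans (hle _ hC hCA) hCK))

end PeligradMax
end
end

section
/- Let H = {f ∈ C_b(ℝ) : there exists a bounded continuous function F : {z ∈ ℂ : Im z ≥ 0} → ℂ which is complex-differentiable at every point of {z ∈ ℂ : Im z > 0} and satisfies F(x) = f(x) for all x ∈ ℝ} (i.e., H = H^∞(ℝ) ∩ C_b(ℝ)). Then H is a strictly closed subalgebra of C_b(ℝ) with H ≠ C_b(ℝ), and H is a maximal strictly closed subalgebra of C_b(ℝ): every strictly closed subalgebra A of C_b(ℝ) with H ⊆ A satisfies A = H or A = C_b(ℝ). -/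
open Set BoundedContinuousFunction

noncomputable section

namespace PeligradCb

/-- A subset of `C_b(ℝ)` is strictly closed if it is closed in the strict topology, i.e. the
topology generated by the seminorms `f ↦ ‖f·g‖_∞`, `g ∈ C₀(ℝ)`. -/
def StrictlyClosed (A : Set (ℝ →ᵇ ℂ)) : Prop :=
  ∀ f : ℝ →ᵇ ℂ,
    (∀ g : ZeroAtInftyContinuousMap ℝ ℂ, ∀ ε > (0 : ℝ),
      ∃ a ∈ A, ‖(f - a) * g.toBCF‖ ≤ ε) → f ∈ A

def IsSubalgebra (A : Set (ℝ →ᵇ ℂ)) : Prop :=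
  (0 : ℝ →ᵇ ℂ) ∈ A ∧ (∀ x ∈ A, ∀ y ∈ A, x + y ∈ A) ∧
  (∀ c : ℂ, ∀ x ∈ A, c • x ∈ A) ∧ ∀ x ∈ A, ∀ y ∈ A, x * y ∈ A

/-- `H^∞(ℝ) ∩ C_b(ℝ)`: bounded continuous functions on `ℝ` admitting a bounded continuous
extension to the closed upper half-plane which is holomorphic on the open upper
half-plane. -/
def Hinf : Set (ℝ →ᵇ ℂ) :=
  {f | ∃ F : ℂ → ℂ,
    (∃ M : ℝ, ∀ z : ℂ, 0 ≤ z.im → ‖F z‖ ≤ M) ∧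
    ContinuousOn F {z : ℂ | 0 ≤ z.im} ∧
    (∀ z : ℂ, 0 < z.im → DifferentiableWithinAt ℂ F {w : ℂ | 0 ≤ w.im} z) ∧
    ∀ x : ℝ, F (x : ℂ) = f x}

section Analysis

open Complex Filter Topology MeasureTheory

lemma norm_add_I_le_mul_norm_sub {a z : ℂ} (ha : a.im ≠ 0) (h : |a.im| ≤ ‖z - a‖) :
    ‖z + I‖ ≤ (1 + ‖a + I‖ / |a.im|) * ‖z - a‖ := by
  have h0 : 0 < |a.im| := abs_pos.2 ha
  have h1 : ‖z + I‖ ≤ ‖z - a‖ + ‖a + I‖ := by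
    rw [show z + I = (z - a) + (a + I) by ring]
    exact norm_add_le _ _
  have h2 : ‖a + I‖ ≤ ‖a + I‖ / |a.im| * ‖z - a‖ := by
    rw [div_mul_eq_mul_div, le_div_iff₀ h0]
    gcongr
  linarith

lemma abs_im_le_norm_ofReal_sub (a : ℂ) (t : ℝ) : |a.im| ≤ ‖(t : ℂ) - a‖ := by
  simpa using abs_im_le_norm ((t : ℂ) - a)

lemma abs_im_le_norm_sub {a z : ℂ} (ha : a.im < 0) (hz : 0 ≤ z.im) : |a.im| ≤ ‖z - a‖ := by
  refine le_trans ?_ (abs_im_le_norm (z - a))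
  rw [sub_im, abs_of_neg ha, abs_of_nonneg (by linarith)]
  linarith

lemma ofReal_sub_ne_zero {a : ℂ} (ha : a.im ≠ 0) (t : ℝ) : (t : ℂ) - a ≠ 0 := fun h ↦ by
  have := abs_im_le_norm_ofReal_sub a t
  rw [h, norm_zero] at this
  exact ha (abs_nonpos_iff.1 this)

lemma norm_ofReal_add_I_sq (t : ℝ) : ‖(t : ℂ) + I‖ ^ 2 = 1 + t ^ 2 := by
  rw [← normSq_eq_norm_sq, normSq_apply]
  simp
  ring

/-- The Cauchy-type kernel `1 / ((z + i) (z - w))`. -/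
def kernel (w z : ℂ) : ℂ := ((z + I) * (z - w))⁻¹

lemma ofReal_add_I_ne_zero (t : ℝ) : (t : ℂ) + I ≠ 0 := by
  simpa using ofReal_sub_ne_zero (a := -I) (by simp) t

lemma norm_kernel_le {w z : ℂ} (hw : w.im ≠ 0) (h : |w.im| ≤ ‖z - w‖) :
    ‖kernel w z‖ ≤ (1 + ‖w + I‖ / |w.im|) * (‖z + I‖ ^ 2)⁻¹ := by
  have h0 : 0 < |w.im| := abs_pos.2 hw
  have h1 := norm_add_I_le_mul_norm_sub hw h
  set C := 1 + ‖w + I‖ / |w.im|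
  have hC : 0 < C := by positivity
  rw [kernel, norm_inv, norm_mul]
  rcases (norm_nonneg (z + I)).eq_or_lt with h2 | h2
  · simp [← h2]
  have h3 : 0 < ‖z - w‖ := h0.trans_le h
  rw [← div_eq_mul_inv, inv_eq_one_div, div_le_div_iff₀ (by positivity) (by positivity)]
  nlinarith

lemma norm_kernel_ofReal_le {w : ℂ} (hw : w.im ≠ 0) (t : ℝ) :
    ‖kernel w t‖ ≤ (1 + ‖w + I‖ / |w.im|) * (1 + t ^ 2)⁻¹ := by
  simpa [norm_ofReal_add_I_sq] using norm_kernel_le hw (abs_im_le_norm_ofReal_sub w t)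

lemma continuous_kernel {w : ℂ} (hw : w.im ≠ 0) : Continuous fun t : ℝ ↦ kernel w t := by
  unfold kernel
  exact Continuous.inv₀ (by fun_prop)
    fun t ↦ mul_ne_zero (ofReal_add_I_ne_zero t) (ofReal_sub_ne_zero hw t)

lemma integrable_mul_kernel (f : ℝ →ᵇ ℂ) {w : ℂ} (hw : w.im ≠ 0) :
    Integrable fun t : ℝ ↦ f t * kernel w t := by
  refine ((integrable_inv_one_add_sq.const_mul (1 + ‖w + I‖ / |w.im|)).const_mul ‖f‖).mono'
    (f.continuous.mul (continuous_kernel hw)).aestronglyMeasurable (Eventually.of_forall fun t ↦ ?_)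
  rw [norm_mul]
  exact mul_le_mul (f.norm_coe_le_norm t) (norm_kernel_ofReal_le hw t) (norm_nonneg _)
    (norm_nonneg _)

/-- Cauchy's theorem on the upper half-plane. -/
lemma integral_mul_kernel_eq_zero {f : ℝ →ᵇ ℂ} (hf : f ∈ Hinf) {w : ℂ} (hw : w.im < 0) :
    ∫ t : ℝ, f t * kernel w t = 0 := by
  obtain ⟨F, ⟨M, hM⟩, hFc, hFd, hFf⟩ := hf
  set C := 1 + ‖w + I‖ / |w.im|
  have hC : 0 ≤ C := by positivity
  have hM0 : 0 ≤ M := (norm_nonneg _).trans (hM 0 le_rfl)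
  set G : ℂ → ℂ := fun z ↦ F z * kernel w z with hG
  have hne : ∀ z : ℂ, 0 ≤ z.im → (z + I) * (z - w) ≠ 0 := fun z hz ↦ by
    refine mul_ne_zero (fun h ↦ ?_) fun h ↦ ?_
    · have := congrArg Complex.im h
      simp at this
      linarith
    · have := congrArg Complex.im h
      simp at this
      linarith
  have hGc : ContinuousOn G {z : ℂ | 0 ≤ z.im} :=
    hFc.mul (ContinuousOn.inv₀ (by fun_prop) hne)
  have hGd : ∀ z : ℂ, 0 < z.im → DifferentiableAt ℂ G z := fun z hz ↦ by
    have h1 : DifferentiableAt ℂ F z := (hFd z hz).differentiableAt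
      (mem_of_superset ((isOpen_lt continuous_const continuous_im).mem_nhds hz)
        fun v hv ↦ (show (0 : ℝ) < v.im from hv).le)
    refine h1.mul ?_
    unfold kernel
    exact DifferentiableAt.inv (by fun_prop) (hne z hz.le)
  have hGb : ∀ R : ℝ, 0 < R → ∀ z : ℂ, 0 ≤ z.im → R ≤ ‖z + I‖ → ‖G z‖ ≤ M * C / R ^ 2 := by
    intro R hR z hz hRz
    have h1 := norm_kernel_le hw.ne (abs_im_le_norm_sub hw hz)
    have h2 : (‖z + I‖ ^ 2)⁻¹ ≤ (R ^ 2)⁻¹ := by gcongr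
    calc ‖G z‖ = ‖F z‖ * ‖kernel w z‖ := norm_mul _ _
      _ ≤ M * (C * (R ^ 2)⁻¹) := by
        refine mul_le_mul (hM z hz) (h1.trans ?_) (norm_nonneg _) hM0
        gcongr
      _ = M * C / R ^ 2 := by ring
  have hlim : Tendsto (fun R : ℝ ↦ ∫ t in (-R)..R, f t * kernel w t) atTop
      (𝓝 (∫ t : ℝ, f t * kernel w t)) :=
    intervalIntegral_tendsto_integral (integrable_mul_kernel f hw.ne) tendsto_neg_atTop_atBot
      tendsto_id
  have hzero : Tendsto (fun R : ℝ ↦ ∫ t in (-R)..R, f t * kernel w t) atTop (𝓝 0) := by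
    have hlim0 : Tendsto (fun R : ℝ ↦ 4 * (M * C) / R) atTop (𝓝 0) :=
      tendsto_const_nhds.div_atTop tendsto_id
    refine squeeze_zero_norm' ?_ hlim0
    filter_upwards [eventually_gt_atTop 0] with R hR
    have hrect := integral_boundary_rect_eq_zero_of_continuousOn_of_differentiableOn G
      (-R : ℂ) (R + R * I)
      (hGc.mono fun z hz ↦ by
        have := hz.2
        simp [uIcc_of_le hR.le] at this
        exact this.1)
      (fun z hz ↦ (hGd z (by
        have := hz.2
        simp [min_eq_left hR.le] at this
        exact this.1)).differentiableWithinAt)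
    simp only [neg_re, ofReal_re, neg_im, ofReal_im, neg_zero, add_re, mul_re, I_re, mul_zero, I_im,
      mul_one, add_zero, add_im, mul_im, zero_add, ofReal_zero, zero_mul,
      smul_eq_mul, sub_self] at hrect
    have e1 : (∫ t in (-R)..R, G t) = ∫ t in (-R)..R, f t * kernel w t := by
      simp only [hG, hFf]
    rw [← e1]
    have b1 : ‖∫ x in (-R)..R, G (x + R * I)‖ ≤ M * C / R ^ 2 * |R - (-R)| := by
      refine intervalIntegral.norm_integral_le_of_norm_le_const fun x _ ↦ hGb R hR _ ?_ ?_
      · simpa using hR.le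
      · refine le_trans ?_ (abs_im_le_norm _)
        simp
        rw [abs_of_nonneg] <;> linarith
    have b2 : ∀ s : ℝ, |s| = R → ‖∫ y in (0 : ℝ)..R, G (s + y * I)‖ ≤ M * C / R ^ 2 * |R - 0| := by
      intro s hs
      refine intervalIntegral.norm_integral_le_of_norm_le_const fun y hy ↦ hGb R hR _ ?_ ?_
      · rw [uIoc_of_le hR.le] at hy
        simpa using hy.1.le
      · refine le_trans ?_ (abs_re_le_norm _)
        simp [hs]
    have b2p := b2 R (abs_of_pos hR)
    have b2n := b2 (-R) (by rw [abs_neg, abs_of_pos hR])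
    have e2 : (∫ t in (-R)..R, G t) = (∫ x in (-R)..R, G (x + R * I))
        - I * (∫ y in (0 : ℝ)..R, G (R + y * I)) + I * ∫ y in (0 : ℝ)..R, G ((-R : ℝ) + y * I) := by
      linear_combination hrect
    have e3 : M * C / R ^ 2 * |R - (-R)| + M * C / R ^ 2 * |R - 0| + M * C / R ^ 2 * |R - 0|
        = 4 * (M * C) / R := by
      rw [sub_zero, sub_neg_eq_add, abs_of_pos hR, abs_of_pos (by linarith)]
      field_simp
      ring
    rw [e2, ← e3]
    refine (norm_add_le _ _).trans (add_le_add ((norm_sub_le _ _).trans (add_le_add b1 ?_)) ?_)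
    · simpa using b2p
    · simpa using b2n
  exact tendsto_nhds_unique hlim hzero

lemma add_I_mul_kernel {z : ℂ} (hz : z.im ≠ 0) (t : ℝ) :
    (z + I) * kernel z t = ((t : ℂ) - z)⁻¹ - ((t : ℂ) + I)⁻¹ := by
  have h1 := ofReal_sub_ne_zero hz t
  have h2 := ofReal_add_I_ne_zero t
  rw [kernel]
  field_simp
  ring

lemma poisson_kernel_eq {z : ℂ} (hz : 0 < z.im) (t : ℝ) :
    ((z.im⁻¹ * (1 + ((t - z.re) / z.im) ^ 2)⁻¹ : ℝ) : ℂ) = (2 * I)⁻¹ *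
      ((z + I) * kernel z t - (starRingEnd ℂ z + I) * kernel (starRingEnd ℂ z) t) := by
  have hz' : (starRingEnd ℂ z).im ≠ 0 := by simpa using hz.ne'
  rw [add_I_mul_kernel hz.ne', add_I_mul_kernel hz']
  have h1 := ofReal_sub_ne_zero hz.ne' t
  have h2 := ofReal_sub_ne_zero hz' t
  have hy : (z.im : ℂ) ≠ 0 := by exact_mod_cast hz.ne'
  have e1 : z - starRingEnd ℂ z = 2 * I * z.im := by
    rw [sub_conj]; push_cast; ring
  have e2 : ((t : ℂ) - z) * (t - starRingEnd ℂ z) = (t - z.re) ^ 2 + z.im ^ 2 := by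
    apply Complex.ext <;> simp [pow_two]
    ring
  have e3 : ((t : ℂ) - z)⁻¹ - ((t : ℂ) - starRingEnd ℂ z)⁻¹ =
      (2 * I * z.im) / ((t - z.re) ^ 2 + z.im ^ 2) := by
    rw [← e1, ← e2]
    field_simp
    ring
  have e4 : ((t : ℂ) - z.re) ^ 2 + z.im ^ 2 ≠ 0 := e2 ▸ mul_ne_zero h1 h2
  rw [sub_sub_sub_cancel_right, e3]
  have e5 : (1 : ℂ) + ((t - z.re) / z.im) ^ 2 = ((t - z.re) ^ 2 + z.im ^ 2) / z.im ^ 2 := by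
    field_simp
    ring
  push_cast
  rw [e5]
  field_simp

/-- The Poisson extension of `f`, written so that it makes sense on the whole plane. -/
def poissonExt (f : ℝ →ᵇ ℂ) (z : ℂ) : ℂ :=
  (Real.pi : ℂ)⁻¹ * ∫ s : ℝ, f (z.re + z.im * s) * ((1 + s ^ 2)⁻¹ : ℝ)

lemma norm_mul_inv_one_add_sq_le (f : ℝ →ᵇ ℂ) (x s : ℝ) :
    ‖f x * ((1 + s ^ 2)⁻¹ : ℝ)‖ ≤ ‖f‖ * (1 + s ^ 2)⁻¹ := by
  rw [norm_mul, norm_real, Real.norm_of_nonneg (by positivity)]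
  gcongr
  exact f.norm_coe_le_norm x

lemma norm_poissonExt_le (f : ℝ →ᵇ ℂ) (z : ℂ) : ‖poissonExt f z‖ ≤ ‖f‖ := by
  have h := norm_integral_le_of_norm_le (integrable_inv_one_add_sq.const_mul ‖f‖)
    (Eventually.of_forall fun s ↦ norm_mul_inv_one_add_sq_le f (z.re + z.im * s) s)
  rw [integral_const_mul, integral_univ_inv_one_add_sq] at h
  rw [poissonExt, norm_mul, norm_inv, norm_real, Real.norm_of_nonneg Real.pi_pos.le,
    inv_mul_le_iff₀ Real.pi_pos, mul_comm]
  exact h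

lemma continuous_inv_one_add_sq : Continuous fun s : ℝ ↦ (((1 + s ^ 2)⁻¹ : ℝ) : ℂ) :=
  continuous_ofReal.comp (Continuous.inv₀ (by fun_prop) fun s ↦ by positivity)

lemma continuous_poissonExt (f : ℝ →ᵇ ℂ) : Continuous (poissonExt f) := by
  refine continuous_const.mul (continuous_of_dominated (fun z ↦ ?_)
    (fun z ↦ Eventually.of_forall fun s ↦ norm_mul_inv_one_add_sq_le f (z.re + z.im * s) s)
    (integrable_inv_one_add_sq.const_mul ‖f‖) (Eventually.of_forall fun s ↦ ?_))
  · exact (Continuous.mul (f.continuous.comp (by fun_prop))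
      continuous_inv_one_add_sq).aestronglyMeasurable
  · exact Continuous.mul (f.continuous.comp (by fun_prop)) continuous_const

lemma poissonExt_ofReal (f : ℝ →ᵇ ℂ) (x : ℝ) : poissonExt f x = f x := by
  have h : (Real.pi : ℂ) ≠ 0 := by exact_mod_cast Real.pi_pos.ne'
  simp only [poissonExt, ofReal_re, ofReal_im, zero_mul, add_zero]
  rw [integral_const_mul, integral_complex_ofReal, integral_univ_inv_one_add_sq]
  field_simp

lemma poissonExt_eq_of_integral_eq_zero {f : ℝ →ᵇ ℂ}
    (hf : ∀ w : ℂ, w.im < 0 → ∫ t : ℝ, f t * kernel w t = 0) {z : ℂ} (hz : 0 < z.im) :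
    poissonExt f z = (2 * Real.pi * I)⁻¹ * ((z + I) * ∫ t : ℝ, f t * kernel z t) := by
  have hz' : (starRingEnd ℂ z).im < 0 := by simpa using hz
  have hpi : (Real.pi : ℂ) ≠ 0 := by exact_mod_cast Real.pi_pos.ne'
  set g : ℝ → ℂ := fun t ↦ f (z.re + t) * ((1 + (t / z.im) ^ 2)⁻¹ : ℝ) with hg
  have e1 : (∫ s : ℝ, f (z.re + z.im * s) * ((1 + s ^ 2)⁻¹ : ℝ)) =
      ∫ t : ℝ, (z.im⁻¹ : ℝ) • g (t - z.re) := by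
    rw [integral_smul, integral_sub_right_eq_self g, ← abs_of_pos (inv_pos.2 hz),
      ← Measure.integral_comp_mul_left]
    refine integral_congr_ae (Eventually.of_forall fun s ↦ ?_)
    simp only [hg]
    rw [mul_div_cancel_left₀ _ hz.ne']
  have e2 : ∀ t : ℝ, (z.im⁻¹ : ℝ) • g (t - z.re) = (2 * I)⁻¹ * (z + I) * (f t * kernel z t) -
      (2 * I)⁻¹ * (starRingEnd ℂ z + I) * (f t * kernel (starRingEnd ℂ z) t) := by
    intro t
    have := poisson_kernel_eq hz t
    simp only [hg, add_sub_cancel, real_smul]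
    rw [ofReal_mul] at this
    linear_combination f t * this
  rw [poissonExt, e1, integral_congr_ae (Eventually.of_forall e2), integral_sub,
    integral_const_mul, integral_const_mul, hf _ hz']
  · field_simp
    ring
  · exact (integrable_mul_kernel f hz.ne').const_mul _
  · exact (integrable_mul_kernel f hz'.ne).const_mul _

lemma differentiableAt_integral_kernel (f : ℝ →ᵇ ℂ) {z : ℂ} (hz : 0 < z.im) :
    DifferentiableAt ℂ (fun w ↦ ∫ t : ℝ, f t * kernel w t) z := by
  set C := 1 + ‖z + I‖ / |z.im|
  have him : ∀ w ∈ Metric.ball z (z.im / 2), 0 < w.im := by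
    intro w hw
    have h1 := (abs_im_le_norm (w - z)).trans_lt (mem_ball_iff_norm.1 hw)
    rw [sub_im, abs_lt] at h1
    linarith [h1.1]
  have hball := Metric.ball_mem_nhds z (half_pos hz)
  refine (hasDerivAt_integral_of_dominated_loc_of_deriv_le (μ := volume) hball
    (F' := fun w t ↦ f t * (kernel w t * ((t : ℂ) - w)⁻¹))
    (bound := fun t ↦ ‖f‖ * (2 * C * (1 + t ^ 2)⁻¹ * (2 / z.im)))
    ?_ (integrable_mul_kernel f hz.ne') ?_ ?_ ?_ ?_).2.differentiableAt
  · filter_upwards [hball] with w hw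
    exact (integrable_mul_kernel f (him w hw).ne').aestronglyMeasurable
  · exact (f.continuous.mul ((continuous_kernel hz.ne').mul
      (Continuous.inv₀ (by fun_prop) (ofReal_sub_ne_zero hz.ne')))).aestronglyMeasurable
  · refine Eventually.of_forall fun t w hw ↦ ?_
    have h0 := abs_im_le_norm_ofReal_sub z t
    rw [abs_of_pos hz] at h0
    have h1 : ‖w - z‖ < z.im / 2 := mem_ball_iff_norm.1 hw
    have h2 : ‖(t : ℂ) - z‖ ≤ 2 * ‖(t : ℂ) - w‖ := by
      have := norm_add_le ((t : ℂ) - w) (w - z)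
      rw [sub_add_sub_cancel] at this
      linarith
    have h3 : ‖((t : ℂ) - w)⁻¹‖ ≤ 2 / z.im := by
      rw [norm_inv, inv_eq_one_div]
      rw [div_le_div_iff₀ (by linarith) hz]
      linarith
    have h4 : ‖kernel w t‖ ≤ 2 * ‖kernel z t‖ := by
      have hpos : 0 < ‖(t : ℂ) + I‖ := norm_pos_iff.2 (ofReal_add_I_ne_zero t)
      rw [kernel, kernel, norm_inv, norm_inv, norm_mul, norm_mul, ← div_eq_mul_inv,
        inv_eq_one_div, div_le_div_iff₀ (mul_pos hpos (by linarith)) (mul_pos hpos (by linarith))]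
      nlinarith
    have h5 := norm_kernel_ofReal_le hz.ne' t
    rw [norm_mul, norm_mul]
    refine mul_le_mul (f.norm_coe_le_norm t) (mul_le_mul ?_ h3 (norm_nonneg _) (by positivity))
      (by positivity) (norm_nonneg _)
    calc ‖kernel w t‖ ≤ 2 * ‖kernel z t‖ := h4
      _ ≤ 2 * (C * (1 + t ^ 2)⁻¹) := by gcongr
      _ = 2 * C * (1 + t ^ 2)⁻¹ := by ring
  · exact ((((integrable_inv_one_add_sq.const_mul (2 * C))).mul_const (2 / z.im)).const_mul ‖f‖)
  · refine Eventually.of_forall fun t w hw ↦ HasDerivAt.const_mul (f t) ?_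
    have h1 := ofReal_sub_ne_zero (him w hw).ne' t
    have h2 := ofReal_add_I_ne_zero t
    have h3 : HasDerivAt (fun v : ℂ ↦ ((t : ℂ) + I) * (t - v)) (((t : ℂ) + I) * (-1)) w :=
      ((hasDerivAt_id w).const_sub (t : ℂ)).const_mul _
    refine (h3.inv (mul_ne_zero h2 h1)).congr_deriv ?_
    rw [kernel]
    field_simp

lemma mem_Hinf_of_integral_eq_zero {f : ℝ →ᵇ ℂ}
    (hf : ∀ w : ℂ, w.im < 0 → ∫ t : ℝ, f t * kernel w t = 0) : f ∈ Hinf := by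
  refine ⟨poissonExt f, ⟨‖f‖, fun z _ ↦ norm_poissonExt_le f z⟩,
    (continuous_poissonExt f).continuousOn, fun z hz ↦ ?_, poissonExt_ofReal f⟩
  have h : DifferentiableAt ℂ
      (fun w ↦ (2 * Real.pi * I)⁻¹ * ((w + I) * ∫ t : ℝ, f t * kernel w t)) z :=
    (DifferentiableAt.mul (by fun_prop) (differentiableAt_integral_kernel f hz)).const_mul _
  refine (h.congr_of_eventuallyEq ?_).differentiableWithinAt
  filter_upwards [(isOpen_lt continuous_const continuous_im).mem_nhds hz] with w hw
  exact poissonExt_eq_of_integral_eq_zero hf hw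

/-- The weight `(1 + t ^ 2) ^ (-1 / 4)`. -/
def weight : ZeroAtInftyContinuousMap ℝ ℂ where
  toFun t := ((1 + t ^ 2) ^ (-(1 / 4) : ℝ) : ℝ)
  continuous_toFun := continuous_ofReal.comp <|
    Continuous.rpow_const (by fun_prop) fun t ↦ Or.inl (by positivity)
  zero_at_infty' := by
    rw [← ofReal_zero]
    refine (continuous_ofReal.tendsto 0).comp ?_
    refine (tendsto_rpow_neg_atTop (by norm_num : (0 : ℝ) < 1 / 4)).comp ?_
    refine tendsto_atTop_add_const_left _ 1 ?_
    have h := (tendsto_pow_atTop (α := ℝ) two_ne_zero).comp (tendsto_norm_cocompact_atTop (E := ℝ))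
    simpa [Function.comp_def] using h

lemma strictlyClosed_Hinf : StrictlyClosed Hinf := by
  intro f hf
  refine mem_Hinf_of_integral_eq_zero fun w hw ↦ ?_
  set C := 1 + ‖w + I‖ / |w.im|
  have hC : 0 ≤ C := by positivity
  have hint : Integrable fun t : ℝ ↦ (1 + t ^ 2) ^ (-(3 / 4) : ℝ) := by
    have := integrable_rpow_neg_one_add_norm_sq (E := ℝ) (μ := volume) (r := 3 / 2)
      (by simp; norm_num)
    convert this using 3 with t
    · simp
    · norm_num
  set J := ∫ t : ℝ, (1 + t ^ 2) ^ (-(3 / 4) : ℝ)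
  have key : ∀ ε > (0 : ℝ), ‖∫ t : ℝ, f t * kernel w t‖ ≤ ε * (C * J) := by
    intro ε hε
    obtain ⟨a, ha, hfa⟩ := hf weight ε hε
    have e : (∫ t : ℝ, f t * kernel w t) = ∫ t : ℝ, (f - a) t * kernel w t := by
      simp only [BoundedContinuousFunction.sub_apply, sub_mul]
      rw [integral_sub (integrable_mul_kernel f hw.ne) (integrable_mul_kernel a hw.ne),
        integral_mul_kernel_eq_zero ha hw, sub_zero]
    rw [e, ← integral_const_mul, ← integral_const_mul]
    refine norm_integral_le_of_norm_le ((hint.const_mul C).const_mul ε)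
      (Eventually.of_forall fun t ↦ ?_)
    have hp : (0 : ℝ) < 1 + t ^ 2 := by positivity
    have h1 : ‖(f - a) t‖ * (1 + t ^ 2) ^ (-(1 / 4) : ℝ) ≤ ε := by
      have := (((f - a) * weight.toBCF).norm_coe_le_norm t).trans hfa
      rw [BoundedContinuousFunction.mul_apply, norm_mul] at this
      have e2 : ‖weight.toBCF t‖ = (1 + t ^ 2) ^ (-(1 / 4) : ℝ) := by
        change ‖(((1 + t ^ 2) ^ (-(1 / 4) : ℝ) : ℝ) : ℂ)‖ = _
        rw [norm_real, Real.norm_of_nonneg (by positivity)]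
      rwa [e2] at this
    have e3 : (1 + t ^ 2)⁻¹ = (1 + t ^ 2) ^ (-(1 / 4) : ℝ) * (1 + t ^ 2) ^ (-(3 / 4) : ℝ) := by
      rw [← Real.rpow_add hp, ← Real.rpow_neg_one]
      norm_num
    have h2 := norm_kernel_ofReal_le hw.ne t
    rw [norm_mul]
    calc ‖(f - a) t‖ * ‖kernel w t‖ ≤ ‖(f - a) t‖ * (C * (1 + t ^ 2)⁻¹) := by gcongr
      _ = ‖(f - a) t‖ * (1 + t ^ 2) ^ (-(1 / 4) : ℝ) * (C * (1 + t ^ 2) ^ (-(3 / 4) : ℝ)) := by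
        rw [e3]; ring
      _ ≤ ε * (C * (1 + t ^ 2) ^ (-(3 / 4) : ℝ)) := by gcongr
  have hlim : Tendsto (fun ε : ℝ ↦ ε * (C * J)) (𝓝[>] 0) (𝓝 0) := by
    have : Tendsto (fun ε : ℝ ↦ ε * (C * J)) (𝓝 0) (𝓝 (0 * (C * J))) := tendsto_id.mul_const _
    rw [zero_mul] at this
    exact this.mono_left nhdsWithin_le_nhds
  exact norm_le_zero_iff.1 (ge_of_tendsto hlim (eventually_mem_nhdsWithin.mono key))

lemma isSubalgebra_Hinf : IsSubalgebra Hinf := by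
  refine ⟨?_, ?_, ?_, ?_⟩
  · exact ⟨0, ⟨0, by simp⟩, continuousOn_const, fun z _ ↦ differentiableWithinAt_const _, by simp⟩
  · rintro f ⟨F, ⟨M, hM⟩, hc, hd, hv⟩ g ⟨G, ⟨N, hN⟩, hc', hd', hv'⟩
    exact ⟨F + G, ⟨M + N, fun z hz ↦ (norm_add_le _ _).trans (add_le_add (hM z hz) (hN z hz))⟩,
      hc.add hc', fun z hz ↦ (hd z hz).add (hd' z hz), fun x ↦ by simp [hv, hv']⟩
  · rintro c f ⟨F, ⟨M, hM⟩, hc, hd, hv⟩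
    refine ⟨c • F, ⟨‖c‖ * M, fun z hz ↦ ?_⟩,
      hc.const_smul c, fun z hz ↦ (hd z hz).const_smul c, fun x ↦ by simp [hv]⟩
    rw [Pi.smul_apply, norm_smul]
    exact mul_le_mul_of_nonneg_left (hM z hz) (norm_nonneg _)
  · rintro f ⟨F, ⟨M, hM⟩, hc, hd, hv⟩ g ⟨G, ⟨N, hN⟩, hc', hd', hv'⟩
    refine ⟨F * G, ⟨M * N, fun z hz ↦ ?_⟩,
      hc.mul hc', fun z hz ↦ (hd z hz).mul (hd' z hz), fun x ↦ by simp [hv, hv']⟩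
    rw [Pi.mul_apply, norm_mul]
    exact mul_le_mul (hM z hz) (hN z hz) (norm_nonneg _) ((norm_nonneg _).trans (hM z hz))

lemma one_mem_Hinf : (1 : ℝ →ᵇ ℂ) ∈ Hinf :=
  ⟨1, ⟨1, by simp⟩, continuousOn_const, fun z _ ↦ differentiableWithinAt_const _, by simp⟩

/-- The function `t ↦ (t - a)⁻¹`, for `a` in the open lower half-plane. -/
def resolventFun (a : ℂ) (ha : a.im < 0) : ℝ →ᵇ ℂ :=
  BoundedContinuousFunction.ofNormedAddCommGroup (fun t : ℝ ↦ ((t : ℂ) - a)⁻¹)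
    (Continuous.inv₀ (by fun_prop) (ofReal_sub_ne_zero ha.ne)) |a.im|⁻¹ fun t ↦ by
      rw [norm_inv]
      exact inv_anti₀ (abs_pos.2 ha.ne) (abs_im_le_norm_ofReal_sub a t)

@[simp]
lemma resolventFun_apply {a : ℂ} (ha : a.im < 0) (t : ℝ) :
    resolventFun a ha t = ((t : ℂ) - a)⁻¹ := rfl

lemma resolventFun_mem_Hinf {a : ℂ} (ha : a.im < 0) : resolventFun a ha ∈ Hinf := by
  have h0 : ∀ z : ℂ, 0 ≤ z.im → z - a ≠ 0 := fun z hz h ↦ by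
    have := abs_im_le_norm_sub ha hz
    rw [h, norm_zero] at this
    exact ha.ne (abs_nonpos_iff.1 this)
  refine ⟨fun z ↦ (z - a)⁻¹, ⟨|a.im|⁻¹, fun z hz ↦ ?_⟩, ContinuousOn.inv₀ (by fun_prop) h0,
    fun z hz ↦ ((differentiableAt_id.sub_const a).inv (h0 z hz.le)).differentiableWithinAt,
    fun x ↦ rfl⟩
  rw [norm_inv]
  exact inv_anti₀ (abs_pos.2 ha.ne) (abs_im_le_norm_sub ha hz)

lemma tendsto_resolventFun {a : ℂ} (ha : a.im < 0) :
    Tendsto (resolventFun a ha) (cocompact ℝ) (𝓝 0) := by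
  have h : Tendsto (fun t : ℝ ↦ (t : ℂ) - a) (cocompact ℝ) (Bornology.cobounded ℂ) := by
    rw [← tendsto_norm_atTop_iff_cobounded]
    refine tendsto_atTop_mono (f := fun t : ℝ ↦ -‖a‖ + ‖t‖) (fun t ↦ ?_)
      (tendsto_atTop_add_const_left _ _ tendsto_norm_cocompact_atTop)
    have := norm_sub_norm_le (t : ℂ) a
    rw [norm_real] at this
    linarith
  exact tendsto_inv₀_cobounded.comp h

lemma tendsto_mul_zero (f : ℝ →ᵇ ℂ) {g : ℝ →ᵇ ℂ} (hg : Tendsto g (cocompact ℝ) (𝓝 0)) :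
    Tendsto (f * g : ℝ →ᵇ ℂ) (cocompact ℝ) (𝓝 0) := by
  refine squeeze_zero_norm (a := fun t ↦ ‖f‖ * ‖g t‖) (fun t ↦ ?_) ?_
  · rw [BoundedContinuousFunction.mul_apply, norm_mul]
    gcongr
    exact f.norm_coe_le_norm t
  · simpa using hg.norm.const_mul ‖f‖

/-- The function `t ↦ i R / (t + i R)`; as `R → ∞` it is an approximate identity. -/
def cutoff (R : ℝ) (hR : 0 < R) : ℝ →ᵇ ℂ :=
  (R * I) • resolventFun (-(R * I)) (by simpa using hR)

lemma cutoff_mem_Hinf {R : ℝ} (hR : 0 < R) : cutoff R hR ∈ Hinf :=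
  isSubalgebra_Hinf.2.2.1 _ _ (resolventFun_mem_Hinf _)

lemma tendsto_cutoff {R : ℝ} (hR : 0 < R) : Tendsto (cutoff R hR) (cocompact ℝ) (𝓝 0) := by
  have h := (tendsto_resolventFun (a := -(R * I)) (by simpa using hR)).const_smul (R * I : ℂ)
  rwa [smul_zero] at h

lemma norm_one_sub_cutoff {R : ℝ} (hR : 0 < R) (t : ℝ) :
    ‖1 - cutoff R hR t‖ ≤ 1 ∧ ‖1 - cutoff R hR t‖ ≤ |t| / R := by
  have ha : (-(R * I) : ℂ).im < 0 := by simpa using hR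
  have h0 := ofReal_sub_ne_zero ha.ne t
  have e : 1 - cutoff R hR t = t / ((t : ℂ) - -(R * I)) := by
    simp only [cutoff, BoundedContinuousFunction.smul_apply, resolventFun_apply, smul_eq_mul]
    field_simp
    ring
  have h1 := abs_im_le_norm_ofReal_sub (-(R * I)) t
  have h2 : |t| ≤ ‖(t : ℂ) - -(R * I)‖ := by simpa using abs_re_le_norm ((t : ℂ) - -(R * I))
  have h3 : R ≤ ‖(t : ℂ) - -(R * I)‖ := by simpa [abs_of_pos hR] using h1
  rw [e, norm_div, norm_real, Real.norm_eq_abs]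
  exact ⟨div_le_one_of_le₀ h2 (norm_nonneg _), by gcongr⟩

lemma exists_cutoff_norm_le (f : ℝ →ᵇ ℂ) (g : ZeroAtInftyContinuousMap ℝ ℂ) {ε : ℝ} (hε : 0 < ε) :
    ∃ (R : ℝ) (hR : 0 < R), ‖(f - f * cutoff R hR) * g.toBCF‖ ≤ ε := by
  have hg : Tendsto (fun t ↦ ‖f‖ * ‖g t‖) (cocompact ℝ) (𝓝 0) := by
    simpa using (zero_at_infty g).norm.const_mul ‖f‖
  obtain ⟨K, hK, hKg⟩ := mem_cocompact'.1 (hg.eventually_lt_const hε)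
  obtain ⟨T, hT0, hT⟩ := hK.isBounded.exists_pos_norm_le
  have hR : 0 < ‖f‖ * ‖g.toBCF‖ * T / ε + 1 := by positivity
  refine ⟨_, hR, (BoundedContinuousFunction.norm_le hε.le).2 fun t ↦ ?_⟩
  obtain ⟨h1, h2⟩ := norm_one_sub_cutoff hR t
  have hf := f.norm_coe_le_norm t
  have hgt := g.toBCF.norm_coe_le_norm t
  have e : ((f - f * cutoff _ hR) * g.toBCF) t = f t * (1 - cutoff _ hR t) * g t := by
    simp only [BoundedContinuousFunction.mul_apply, BoundedContinuousFunction.sub_apply]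
    rw [show g.toBCF t = g t from rfl]
    ring
  rw [e, norm_mul, norm_mul]
  by_cases ht : ‖f‖ * ‖g t‖ < ε
  · calc ‖f t‖ * ‖1 - cutoff _ hR t‖ * ‖g t‖ ≤ ‖f‖ * 1 * ‖g t‖ := by gcongr
      _ ≤ ε := by rw [mul_one]; exact ht.le
  · have htT : |t| ≤ T := hT t (hKg ht)
    set R := ‖f‖ * ‖g.toBCF‖ * T / ε + 1 with hRdef
    calc ‖f t‖ * ‖1 - cutoff _ hR t‖ * ‖g t‖ ≤ ‖f‖ * (T / R) * ‖g.toBCF‖ := by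
          refine mul_le_mul (mul_le_mul hf (h2.trans (by gcongr)) (norm_nonneg _) (norm_nonneg _))
            hgt (norm_nonneg _) (by positivity)
      _ = ‖f‖ * ‖g.toBCF‖ * T / R := by ring
      _ ≤ ε := by
        rw [div_le_iff₀ hR, hRdef, mul_add, mul_div_cancel₀ _ hε.ne']
        linarith

/-- The function `t ↦ (t - i) / (t + i)`. -/
def cayley : ℝ →ᵇ ℂ := 1 - (2 * I) • resolventFun (-I) (by simp)

lemma cayley_apply (t : ℝ) : cayley t = ((t : ℂ) - I) / (t + I) := by
  have := ofReal_add_I_ne_zero t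
  change 1 - 2 * I * ((t : ℂ) - -I)⁻¹ = _
  rw [sub_neg_eq_add]
  field_simp
  ring

lemma cayley_mul_star : cayley * star cayley = 1 := by
  ext t
  have h1 := ofReal_add_I_ne_zero t
  have h2 : (t : ℂ) - I ≠ 0 := ofReal_sub_ne_zero (by simp) t
  simp only [BoundedContinuousFunction.mul_apply, BoundedContinuousFunction.star_apply,
    cayley_apply, BoundedContinuousFunction.coe_one, Pi.one_apply]
  rw [← starRingEnd_apply]
  simp only [map_div₀, map_sub, map_add, conj_ofReal, conj_I, sub_neg_eq_add, ← sub_eq_add_neg]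
  field_simp

lemma sub_mem_Hinf {f g : ℝ →ᵇ ℂ} (hf : f ∈ Hinf) (hg : g ∈ Hinf) : f - g ∈ Hinf := by
  have := isSubalgebra_Hinf.2.1 _ hf _ (isSubalgebra_Hinf.2.2.1 (-1) _ hg)
  rwa [neg_one_smul, ← sub_eq_add_neg] at this

lemma cayley_mem_Hinf : cayley ∈ Hinf :=
  sub_mem_Hinf one_mem_Hinf (isSubalgebra_Hinf.2.2.1 _ _ (resolventFun_mem_Hinf _))

lemma cayley_pow_mem_Hinf (n : ℕ) : cayley ^ n ∈ Hinf := by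
  induction n with
  | zero => exact one_mem_Hinf
  | succ n ih => exact isSubalgebra_Hinf.2.2.2 _ ih _ cayley_mem_Hinf

/-- The mean with respect to the harmonic measure on `ℝ` seen from `i`. -/
def harmonicMean (f : ℝ →ᵇ ℂ) : ℂ := poissonExt f I

lemma harmonicMean_eq (f : ℝ →ᵇ ℂ) :
    harmonicMean f = (Real.pi : ℂ)⁻¹ * ∫ s : ℝ, f s * ((1 + s ^ 2)⁻¹ : ℝ) := by
  simp [harmonicMean, poissonExt]

lemma integrable_mul_inv_one_add_sq (f : ℝ →ᵇ ℂ) :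
    Integrable fun s : ℝ ↦ f s * ((1 + s ^ 2)⁻¹ : ℝ) :=
  (integrable_inv_one_add_sq.const_mul ‖f‖).mono'
    (f.continuous.mul continuous_inv_one_add_sq).aestronglyMeasurable
    (Eventually.of_forall fun s ↦ norm_mul_inv_one_add_sq_le f s s)

lemma harmonicMean_add (f g : ℝ →ᵇ ℂ) :
    harmonicMean (f + g) = harmonicMean f + harmonicMean g := by
  simp only [harmonicMean_eq, BoundedContinuousFunction.add_apply, add_mul]
  rw [integral_add (integrable_mul_inv_one_add_sq f) (integrable_mul_inv_one_add_sq g), mul_add]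

lemma harmonicMean_smul (c : ℂ) (f : ℝ →ᵇ ℂ) :
    harmonicMean (c • f) = c * harmonicMean f := by
  simp only [harmonicMean_eq, BoundedContinuousFunction.smul_apply, smul_eq_mul, mul_assoc]
  rw [integral_const_mul]
  ring

lemma harmonicMean_one : harmonicMean 1 = 1 := by
  have h : (Real.pi : ℂ) ≠ 0 := by exact_mod_cast Real.pi_pos.ne'
  simp only [harmonicMean_eq, BoundedContinuousFunction.coe_one, Pi.one_apply, one_mul]
  rw [integral_complex_ofReal, integral_univ_inv_one_add_sq, inv_mul_cancel₀ h]

lemma harmonicMean_star (f : ℝ →ᵇ ℂ) :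
    harmonicMean (star f) = starRingEnd ℂ (harmonicMean f) := by
  simp only [harmonicMean_eq, map_mul, map_inv₀, conj_ofReal]
  rw [← integral_conj]
  simp only [map_mul, conj_ofReal, BoundedContinuousFunction.star_apply]
  rfl

lemma norm_harmonicMean_le (f : ℝ →ᵇ ℂ) : ‖harmonicMean f‖ ≤ ‖f‖ := norm_poissonExt_le f I

lemma harmonicMean_cayley_mul (f : ℝ →ᵇ ℂ) :
    harmonicMean (cayley * f) = (Real.pi : ℂ)⁻¹ * ∫ t : ℝ, f t * kernel (-I) t := by
  rw [harmonicMean_eq]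
  congr 1
  refine integral_congr_ae (Eventually.of_forall fun t ↦ ?_)
  have h1 := ofReal_add_I_ne_zero t
  have h2 : (t : ℂ) - I ≠ 0 := ofReal_sub_ne_zero (by simp) t
  have e : (1 : ℂ) + t ^ 2 = (t + I) * (t - I) := by
    linear_combination I_sq
  simp only [BoundedContinuousFunction.mul_apply, cayley_apply, kernel]
  push_cast
  rw [e, sub_neg_eq_add]
  field_simp

lemma harmonicMean_cayley_mul_of_mem {f : ℝ →ᵇ ℂ} (hf : f ∈ Hinf) :
    harmonicMean (cayley * f) = 0 := by
  rw [harmonicMean_cayley_mul, integral_mul_kernel_eq_zero hf (by simp), mul_zero]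

lemma Hinf_ne_univ : Hinf ≠ univ := by
  intro h
  have h1 := harmonicMean_cayley_mul_of_mem (h ▸ mem_univ (star cayley))
  rw [cayley_mul_star, harmonicMean_one] at h1
  exact one_ne_zero h1

/-- Restriction to `ℝ` of a continuous function on the one-point compactification of `ℝ`. -/
def restrictReal (G : C(OnePoint ℝ, ℂ)) : ℝ →ᵇ ℂ :=
  (BoundedContinuousFunction.mkOfCompact G).compContinuous ⟨_, OnePoint.continuous_coe⟩

@[simp]
lemma restrictReal_apply (G : C(OnePoint ℝ, ℂ)) (t : ℝ) : restrictReal G t = G t := rfl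

lemma restrictReal_add (G K : C(OnePoint ℝ, ℂ)) :
    restrictReal (G + K) = restrictReal G + restrictReal K := rfl

lemma restrictReal_smul (c : ℂ) (G : C(OnePoint ℝ, ℂ)) :
    restrictReal (c • G) = c • restrictReal G := rfl

lemma restrictReal_pow (G : C(OnePoint ℝ, ℂ)) (n : ℕ) :
    restrictReal (G ^ n) = restrictReal G ^ n := by
  ext t
  simp

lemma restrictReal_star (G : C(OnePoint ℝ, ℂ)) :
    restrictReal (star G) = star (restrictReal G) := rfl

lemma norm_restrictReal_sub_le (G K : C(OnePoint ℝ, ℂ)) :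
    ‖restrictReal G - restrictReal K‖ ≤ ‖G - K‖ :=
  (BoundedContinuousFunction.norm_le (norm_nonneg _)).2 fun t ↦ (G - K).norm_coe_le_norm t

/-- The extension to the one-point compactification of `ℝ` of a function with limit `y` at
infinity. -/
def extendOnePoint (f : ℝ →ᵇ ℂ) (y : ℂ) (hf : Tendsto f (cocompact ℝ) (𝓝 y)) :
    C(OnePoint ℝ, ℂ) :=
  OnePoint.continuousMapMk f.toContinuousMap y (by rwa [coclosedCompact_eq_cocompact])

lemma restrictReal_extendOnePoint (f : ℝ →ᵇ ℂ) (y : ℂ) (hf : Tendsto f (cocompact ℝ) (𝓝 y)) :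
    restrictReal (extendOnePoint f y hf) = f := rfl

lemma tendsto_cayley : Tendsto cayley (cocompact ℝ) (𝓝 1) := by
  have h := ((tendsto_resolventFun (a := -I) (by simp)).const_smul (2 * I)).const_sub 1
  rwa [smul_zero, sub_zero] at h

/-- The Cayley transform as a function on the one-point compactification. -/
def cayleyOnePoint : C(OnePoint ℝ, ℂ) := extendOnePoint cayley 1 tendsto_cayley

lemma cayley_ne_one (t : ℝ) : cayley t ≠ 1 := by
  rw [cayley_apply, Ne, div_eq_one_iff_eq (ofReal_add_I_ne_zero t)]
  intro h
  have := congrArg Complex.im h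
  norm_num at this

lemma cayley_injective : Function.Injective cayley := by
  intro s t h
  rw [cayley_apply, cayley_apply,
    div_eq_div_iff (ofReal_add_I_ne_zero s) (ofReal_add_I_ne_zero t)] at h
  have := congrArg Complex.im h
  simp at this
  linarith

lemma cayleyOnePoint_injective : Function.Injective cayleyOnePoint := by
  intro x y h
  induction x using OnePoint.rec with
  | infty =>
    induction y using OnePoint.rec with
    | infty => rfl
    | coe t => exact absurd h.symm (cayley_ne_one t)
  | coe s =>
    induction y using OnePoint.rec with
    | infty => exact absurd h (cayley_ne_one s)
    | coe t => exact congrArg _ (cayley_injective h)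

lemma topologicalClosure_adjoin_cayleyOnePoint :
    (StarAlgebra.adjoin ℂ {cayleyOnePoint}).topologicalClosure = ⊤ := by
  refine ContinuousMap.starSubalgebra_topologicalClosure_eq_top_of_separatesPoints _ ?_
  intro x y hxy
  exact ⟨cayleyOnePoint, ⟨cayleyOnePoint, StarAlgebra.subset_adjoin ℂ _ rfl, rfl⟩,
    fun h ↦ hxy (cayleyOnePoint_injective h)⟩

lemma exists_mem_adjoin_norm_sub_lt (G : C(OnePoint ℝ, ℂ)) {ε : ℝ} (hε : 0 < ε) :
    ∃ p ∈ StarAlgebra.adjoin ℂ {cayleyOnePoint}, ‖G - p‖ < ε := by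
  have h : G ∈ (StarAlgebra.adjoin ℂ {cayleyOnePoint}).topologicalClosure := by
    rw [topologicalClosure_adjoin_cayleyOnePoint]
    trivial
  obtain ⟨p, hp, hd⟩ := Metric.mem_closure_iff.1 h ε hε
  exact ⟨p, hp, by rwa [← dist_eq_norm]⟩

lemma star_cayleyOnePoint_mul : star cayleyOnePoint * cayleyOnePoint = 1 := by
  ext x
  induction x using OnePoint.rec with
  | infty => simp [cayleyOnePoint, extendOnePoint, OnePoint.continuousMapMk]
  | coe t =>
    have := DFunLike.congr_fun cayley_mul_star t
    rw [mul_comm] at this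
    exact this

lemma mem_closure_cayleyOnePoint {x : C(OnePoint ℝ, ℂ)}
    (hx : x ∈ Submonoid.closure ({cayleyOnePoint} ∪ star {cayleyOnePoint})) :
    ∃ n : ℕ, x = cayleyOnePoint ^ n ∨ x = star cayleyOnePoint ^ n := by
  induction hx using Submonoid.closure_induction_left with
  | one => exact ⟨0, Or.inl rfl⟩
  | mul_left x hx y hy ih =>
    obtain ⟨n, rfl | rfl⟩ := ih <;> rcases hx with rfl | hx
    · exact ⟨n + 1, Or.inl (pow_succ' _ _).symm⟩
    · rw [Set.star_singleton, mem_singleton_iff] at hx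
      subst hx
      rcases n with _ | n
      · exact ⟨1, Or.inr (by simp)⟩
      · exact ⟨n, Or.inl (by rw [pow_succ', ← mul_assoc, star_cayleyOnePoint_mul, one_mul])⟩
    · rcases n with _ | n
      · exact ⟨1, Or.inl (by simp)⟩
      · refine ⟨n, Or.inr ?_⟩
        rw [pow_succ', ← mul_assoc, mul_comm cayleyOnePoint, star_cayleyOnePoint_mul, one_mul]
    · rw [Set.star_singleton, mem_singleton_iff] at hx
      subst hx
      exact ⟨n + 1, Or.inr (pow_succ' _ _).symm⟩

lemma adjoin_cayleyOnePoint_induction {P : C(OnePoint ℝ, ℂ) → Prop}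
    (hpow : ∀ n : ℕ, P (cayleyOnePoint ^ n)) (hstar : ∀ n : ℕ, P (star cayleyOnePoint ^ n))
    (hzero : P 0) (hadd : ∀ x y, P x → P y → P (x + y)) (hsmul : ∀ (c : ℂ) x, P x → P (c • x))
    {p : C(OnePoint ℝ, ℂ)} (hp : p ∈ StarAlgebra.adjoin ℂ {cayleyOnePoint}) : P p := by
  have hp' : p ∈ Submodule.span ℂ
      (Submonoid.closure ({cayleyOnePoint} ∪ star {cayleyOnePoint}) : Set C(OnePoint ℝ, ℂ)) := by
    rw [← Algebra.adjoin_eq_span]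
    exact hp
  clear hp
  induction hp' using Submodule.span_induction with
  | mem x hx =>
    obtain ⟨n, rfl | rfl⟩ := mem_closure_cayleyOnePoint hx
    exacts [hpow n, hstar n]
  | zero => exact hzero
  | add x y _ _ hx hy => exact hadd x y hx hy
  | smul c x _ hx => exact hsmul c x hx

lemma exists_decomposition_of_mem_adjoin {p : C(OnePoint ℝ, ℂ)}
    (hp : p ∈ StarAlgebra.adjoin ℂ {cayleyOnePoint}) :
    ∃ c : ℂ, ∃ a ∈ Hinf, ∃ b ∈ Hinf,
      restrictReal p = c • 1 + cayley * a + star (cayley * b) := by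
  have h0 := isSubalgebra_Hinf.1
  refine adjoin_cayleyOnePoint_induction (P := fun p ↦ ∃ c : ℂ, ∃ a ∈ Hinf, ∃ b ∈ Hinf,
    restrictReal p = c • 1 + cayley * a + star (cayley * b))
    (fun n ↦ ?_) (fun n ↦ ?_) ?_ ?_ ?_ hp
  · rcases n with _ | n
    · exact ⟨1, 0, h0, 0, h0, by ext; simp⟩
    · refine ⟨0, cayley ^ n, cayley_pow_mem_Hinf n, 0, h0, ?_⟩
      rw [restrictReal_pow, cayleyOnePoint, restrictReal_extendOnePoint, pow_succ']
      simp
  · rcases n with _ | n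
    · exact ⟨1, 0, h0, 0, h0, by ext; simp⟩
    · refine ⟨0, 0, h0, cayley ^ n, cayley_pow_mem_Hinf n, ?_⟩
      rw [restrictReal_pow, restrictReal_star, cayleyOnePoint, restrictReal_extendOnePoint,
        ← pow_succ', star_pow]
      simp
  · exact ⟨0, 0, h0, 0, h0, by ext; simp⟩
  · rintro x y ⟨c, a, ha, b, hb, h⟩ ⟨c', a', ha', b', hb', h'⟩
    refine ⟨c + c', a + a', isSubalgebra_Hinf.2.1 _ ha _ ha', b + b',
      isSubalgebra_Hinf.2.1 _ hb _ hb', ?_⟩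
    rw [restrictReal_add, h, h', add_smul, mul_add, mul_add, star_add]
    abel
  · rintro k x ⟨c, a, ha, b, hb, h⟩
    refine ⟨k * c, k • a, isSubalgebra_Hinf.2.2.1 _ _ ha, star k • b,
      isSubalgebra_Hinf.2.2.1 _ _ hb, ?_⟩
    rw [restrictReal_smul, h, mul_smul_comm, mul_smul_comm, star_smul, star_star, smul_add,
      smul_add, mul_smul]

lemma isClosed_of_strictlyClosed {A : Set (ℝ →ᵇ ℂ)} (hA : StrictlyClosed A) : IsClosed A := by
  refine isClosed_of_closure_subset fun f hf ↦ hA f fun g ε hε ↦ ?_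
  have hd : 0 < ε / (‖g.toBCF‖ + 1) := by positivity
  obtain ⟨a, ha, hfa⟩ := Metric.mem_closure_iff.1 hf _ hd
  refine ⟨a, ha, (norm_mul_le _ _).trans ?_⟩
  rw [dist_eq_norm] at hfa
  calc ‖f - a‖ * ‖g.toBCF‖ ≤ ε / (‖g.toBCF‖ + 1) * (‖g.toBCF‖ + 1) := by
        gcongr
        linarith
    _ = ε := by field_simp

/-- If a function in a closed subalgebra is close to `u - 1` with `u` skew-adjoint, then it is
invertible in the subalgebra. -/
lemma exists_mul_eq_one_of_skew {S : Subalgebra ℂ (ℝ →ᵇ ℂ)} (hS : IsClosed (S : Set (ℝ →ᵇ ℂ)))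
    {u q h : ℝ →ᵇ ℂ} (hu : star u = -u) (hq : q ∈ S) (hh : ‖h‖ ≤ 1 / 2) (huq : u = 1 + q + h) :
    ∃ v ∈ S, q * v = 1 := by
  set M := ‖u‖
  set δ : ℝ := 1 / (4 * (M ^ 2 + 1)) with hδdef
  have hδ : 0 < δ := by positivity
  have hδM : δ * M ^ 2 ≤ 1 / 4 := by
    rw [hδdef, div_mul_eq_mul_div, div_le_div_iff₀ (by positivity) (by norm_num)]
    linarith
  have h1 : ‖1 + (δ : ℂ) • u‖ ≤ 1 + δ ^ 2 * M ^ 2 := by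
    refine (BoundedContinuousFunction.norm_le (by positivity)).2 fun t ↦ ?_
    have hre : (u t).re = 0 := by
      have h2 : (u t).re = -(u t).re := congrArg Complex.re (DFunLike.congr_fun hu t)
      linarith
    have him : (u t).im ^ 2 ≤ M ^ 2 :=
      sq_le_sq.2 (((abs_im_le_norm _).trans (u.norm_coe_le_norm t)).trans (le_abs_self _))
    have hsq : ‖(1 + (δ : ℂ) • u) t‖ ^ 2 = 1 + δ ^ 2 * (u t).im ^ 2 := by
      change ‖1 + (δ : ℂ) * u t‖ ^ 2 = _
      rw [← normSq_eq_norm_sq, normSq_apply]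
      simp [hre]
      ring
    refine (sq_le_sq₀ (norm_nonneg _) (by positivity)).1 ?_
    rw [hsq]
    nlinarith [mul_le_mul_of_nonneg_left him (sq_nonneg δ), sq_nonneg (δ ^ 2 * M ^ 2),
      mul_nonneg (sq_nonneg δ) (sq_nonneg M)]
  have hδ1 : (1 + δ : ℂ) ≠ 0 := by
    exact_mod_cast (by positivity : (1 + δ : ℝ) ≠ 0)
  have hδ0 : (δ : ℂ) ≠ 0 := by exact_mod_cast hδ.ne'
  set k : ℂ := -(δ / (1 + δ)) with hk
  have e : (1 + δ : ℂ) • (1 - k • q) = (1 + (δ : ℂ) • u) - (δ : ℂ) • h := by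
    have hk' : (1 + δ : ℂ) * k = -δ := by rw [hk]; field_simp
    rw [smul_sub, smul_smul, hk', huq]
    module
  have hlt : ‖1 - k • q‖ < 1 := by
    have h2 : ‖(1 + δ : ℂ) • (1 - k • q)‖ < 1 + δ := by
      rw [e]
      refine (norm_sub_le _ _).trans_lt ?_
      rw [norm_smul, norm_real, Real.norm_of_nonneg hδ.le]
      nlinarith
    rw [norm_smul] at h2
    have h3 : ‖(1 + δ : ℂ)‖ = 1 + δ := by
      rw [← ofReal_one, ← ofReal_add, norm_real, Real.norm_of_nonneg (by positivity)]
    rw [h3] at h2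
    by_contra hcon
    push Not at hcon
    nlinarith
  have : CompleteSpace S := hS.completeSpace_coe
  let x : S := ⟨1 - k • q, S.sub_mem S.one_mem (S.smul_mem hq k)⟩
  obtain ⟨v, hv⟩ := (isUnit_one_sub_of_norm_lt_one (x := x) hlt).exists_right_inv
  have hv' := congrArg Subtype.val hv
  refine ⟨k • (v : ℝ →ᵇ ℂ), S.smul_mem v.2 k, ?_⟩
  have e2 : (1 - (1 - k • q)) * (v : ℝ →ᵇ ℂ) = 1 := hv'
  rw [sub_sub_cancel, smul_mul_assoc] at e2
  rw [mul_smul_comm, e2]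

/-- An element of the algebra outside `Hinf` can be modified so as to vanish at infinity and have
a nonzero negative Fourier coefficient. -/
lemma exists_harmonicMean_ne_zero {A : Set (ℝ →ᵇ ℂ)} (hA : IsSubalgebra A) (hHA : Hinf ⊆ A)
    {f : ℝ →ᵇ ℂ} (hf : f ∈ A) (hfH : f ∉ Hinf) :
    ∃ g ∈ A, Tendsto g (cocompact ℝ) (𝓝 0) ∧ harmonicMean (cayley * g) = 1 := by
  obtain ⟨R, hR, hfR⟩ : ∃ (R : ℝ) (hR : 0 < R), f * cutoff R hR ∉ Hinf := by
    by_contra! hcon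
    refine hfH (strictlyClosed_Hinf f fun g ε hε ↦ ?_)
    obtain ⟨R, hR, h⟩ := exists_cutoff_norm_le f g hε
    exact ⟨_, hcon R hR, h⟩
  obtain ⟨w, hw, hne⟩ : ∃ w : ℂ, w.im < 0 ∧ ∫ t : ℝ, (f * cutoff R hR) t * kernel w t ≠ 0 := by
    by_contra! hcon
    exact hfR (mem_Hinf_of_integral_eq_zero hcon)
  set m : ℝ →ᵇ ℂ := 1 + (w + I) • resolventFun w hw with hm
  have hmH : m ∈ Hinf := isSubalgebra_Hinf.2.1 _ one_mem_Hinf _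
    (isSubalgebra_Hinf.2.2.1 _ _ (resolventFun_mem_Hinf hw))
  set g := m * (f * cutoff R hR)
  have hgA : g ∈ A := hA.2.2.2 _ (hHA hmH) _ (hA.2.2.2 _ hf _ (hHA (cutoff_mem_Hinf hR)))
  have hg0 : Tendsto g (cocompact ℝ) (𝓝 0) :=
    tendsto_mul_zero _ (tendsto_mul_zero _ (tendsto_cutoff hR))
  have hmean : harmonicMean (cayley * g) ≠ 0 := by
    rw [harmonicMean_cayley_mul]
    refine mul_ne_zero (inv_ne_zero (by exact_mod_cast Real.pi_pos.ne')) ?_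
    convert hne using 2
    ext t
    have h1 := ofReal_add_I_ne_zero t
    have h2 := ofReal_sub_ne_zero hw.ne t
    change (1 + (w + I) * ((t : ℂ) - w)⁻¹) * (f * cutoff R hR) t * kernel (-I) t = _
    rw [kernel, kernel, sub_neg_eq_add]
    field_simp
    ring
  refine ⟨(harmonicMean (cayley * g))⁻¹ • g, hA.2.2.1 _ _ hgA, ?_, ?_⟩
  · have h := hg0.const_smul (harmonicMean (cayley * g))⁻¹
    rwa [smul_zero] at h
  · rw [mul_smul_comm, harmonicMean_smul, inv_mul_cancel₀ hmean]

lemma star_cayley_mem {A : Set (ℝ →ᵇ ℂ)} (hA : StrictlyClosed A) (hA' : IsSubalgebra A)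
    (hHA : Hinf ⊆ A) {f : ℝ →ᵇ ℂ} (hf : f ∈ A) (hfH : f ∉ Hinf) : star cayley ∈ A := by
  obtain ⟨g, hgA, hg0, hg1⟩ := exists_harmonicMean_ne_zero hA' hHA hf hfH
  let S : Subalgebra ℂ (ℝ →ᵇ ℂ) :=
    { carrier := A
      mul_mem' := fun ha hb ↦ hA'.2.2.2 _ ha _ hb
      add_mem' := fun ha hb ↦ hA'.2.1 _ ha _ hb
      algebraMap_mem' := fun c ↦ by
        rw [Algebra.algebraMap_eq_smul_one]
        exact hA'.2.2.1 _ _ (hHA one_mem_Hinf) }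
  have hgS : g ∈ S := hgA
  obtain ⟨p, hp, hpG⟩ := exists_mem_adjoin_norm_sub_lt
    (extendOnePoint (cayley * g) 0 (tendsto_mul_zero _ hg0)) (by norm_num : (0 : ℝ) < 1 / 4)
  have hp' := (norm_restrictReal_sub_le _ _).trans hpG.le
  rw [restrictReal_extendOnePoint] at hp'
  obtain ⟨c, a, ha, b, hb, hdec⟩ := exists_decomposition_of_mem_adjoin hp
  have haS : a ∈ S := hHA ha
  have hbS : b ∈ S := hHA hb
  have hzS : cayley ∈ S := hHA cayley_mem_Hinf
  have hmean : harmonicMean (restrictReal p) = c := by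
    rw [hdec, harmonicMean_add, harmonicMean_add, harmonicMean_smul, harmonicMean_one,
      harmonicMean_star, harmonicMean_cayley_mul_of_mem ha, harmonicMean_cayley_mul_of_mem hb]
    simp
  have hc : ‖1 - c‖ ≤ 1 / 4 := by
    have h := (norm_harmonicMean_le (cayley * g - restrictReal p)).trans hp'
    have e : harmonicMean (cayley * g - restrictReal p) = 1 - c := by
      rw [sub_eq_add_neg, ← neg_one_smul ℂ, harmonicMean_add, harmonicMean_smul, hg1, hmean]
      ring
    rwa [e] at h
  set h : ℝ →ᵇ ℂ := (cayley * g - restrictReal p) - (1 - c) • 1 with hh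
  have hnorm : ‖h‖ ≤ 1 / 2 := by
    have h2 : ‖(1 - c) • (1 : ℝ →ᵇ ℂ)‖ ≤ 1 / 4 := by
      rw [norm_smul, norm_one, mul_one]
      exact hc
    have := norm_sub_le (cayley * g - restrictReal p) ((1 - c) • 1)
    linarith
  obtain ⟨v, hv, hqv⟩ := exists_mul_eq_one_of_skew (S := S) (isClosed_of_strictlyClosed hA)
    (u := cayley * b - star (cayley * b)) (q := cayley * (a + b - g)) (h := h)
    (by rw [star_sub, star_star, neg_sub])
    (S.mul_mem hzS (S.sub_mem (S.add_mem haS hbS) hgS)) hnorm (by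
      rw [hh, hdec, sub_smul, one_smul, mul_sub, mul_add]
      abel)
  have e : star cayley = (a + b - g) * v := by
    calc star cayley = star cayley * (cayley * (a + b - g) * v) := by rw [hqv, mul_one]
      _ = cayley * star cayley * ((a + b - g) * v) := by ring
      _ = (a + b - g) * v := by rw [cayley_mul_star, one_mul]
  rw [e]
  exact S.mul_mem (S.sub_mem (S.add_mem haS hbS) hgS) hv

lemma restrictReal_mem {A : Set (ℝ →ᵇ ℂ)} (hA : StrictlyClosed A) (hA' : IsSubalgebra A)
    (hHA : Hinf ⊆ A) (hstar : star cayley ∈ A) (G : C(OnePoint ℝ, ℂ)) : restrictReal G ∈ A := by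
  have hadj : ∀ p ∈ StarAlgebra.adjoin ℂ {cayleyOnePoint}, restrictReal p ∈ A := by
    intro p hp
    refine adjoin_cayleyOnePoint_induction (P := fun p ↦ restrictReal p ∈ A)
      (fun n ↦ ?_) (fun n ↦ ?_) hA'.1 (fun x y hx hy ↦ hA'.2.1 _ hx _ hy)
      (fun c x hx ↦ hA'.2.2.1 _ _ hx) hp
    · rw [restrictReal_pow]
      exact hHA (cayley_pow_mem_Hinf n)
    · rw [restrictReal_pow]
      induction n with
      | zero => exact hHA one_mem_Hinf
      | succ n ih => exact hA'.2.2.2 _ ih _ hstar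
  rw [← (isClosed_of_strictlyClosed hA).closure_eq]
  refine Metric.mem_closure_iff.2 fun ε hε ↦ ?_
  obtain ⟨p, hp, h⟩ := exists_mem_adjoin_norm_sub_lt G hε
  exact ⟨_, hadj p hp, by
    rw [dist_eq_norm]
    exact (norm_restrictReal_sub_le G p).trans_lt h⟩

lemma eq_univ_of_star_cayley_mem {A : Set (ℝ →ᵇ ℂ)} (hA : StrictlyClosed A)
    (hA' : IsSubalgebra A) (hHA : Hinf ⊆ A) (hstar : star cayley ∈ A) : A = univ := by
  refine eq_univ_of_forall fun f ↦ hA f fun g ε hε ↦ ?_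
  obtain ⟨R, hR, h⟩ := exists_cutoff_norm_le f g hε
  exact ⟨_, restrictReal_mem hA hA' hHA hstar
    (extendOnePoint (f * cutoff R hR) 0 (tendsto_mul_zero f (tendsto_cutoff hR))), h⟩

end Analysis

/-- The analytic subalgebra `H^∞(ℝ) ∩ C_b(ℝ)` is a maximal strictly closed subalgebra of
`C_b(ℝ)`, the multiplier algebra of `C₀(ℝ)` acted on by translations. -/
theorem hinf_maximal_strictly_closed :
    StrictlyClosed (Hinf) ∧ IsSubalgebra (Hinf) ∧ Hinf ≠ (univ : Set (ℝ →ᵇ ℂ)) ∧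
    ∀ A : Set (ℝ →ᵇ ℂ), StrictlyClosed A → IsSubalgebra A → Hinf ⊆ A →
      A = Hinf ∨ A = (univ : Set (ℝ →ᵇ ℂ)) := by
  refine ⟨strictlyClosed_Hinf, isSubalgebra_Hinf, Hinf_ne_univ, fun A hA hA' hHA ↦ ?_⟩
  by_cases h : A ⊆ Hinf
  · exact Or.inl (h.antisymm hHA)
  · obtain ⟨f, hf, hfH⟩ := not_subset.1 h
    exact Or.inr (eq_univ_of_star_cayley_mem hA hA' hHA (star_cayley_mem hA hA' hHA hf hfH))

end PeligradCb
end
end
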